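/- Fix r ∈ ℕ_0 and let λ^{(n)} be the n-th diagram of the Plancherel growth process. Then the total variation distance between (i) the Plancherel measure Pl_n on 𝕐_n, i.e., the distribution of λ^{(n)}, and (ii) the conditional distribution of λ^{(n)} given that the event E_r^{(n)} occurred, converges to zero as n → ∞. -/

import Mathlib

open MeasureTheory Filter

/-- The number of standard Young tableaux of shape `μ`: bijective fillings of the cells of `μ`
by `0, 1, …, μ.card - 1` that are strictly increasing along rows and columns. -/
noncomputable def sytCount (μ : YoungDiagram) : ℕ :=
  Nat.card {T : μ.cells → Fin μ.card //
    Function.Bijective T ∧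
      ∀ a b : μ.cells, (a : ℕ × ℕ).1 ≤ (b : ℕ × ℕ).1 → (a : ℕ × ℕ).2 ≤ (b : ℕ × ℕ).2 →
        a ≠ b → T a < T b}

/-- `lam 0 ↗ lam 1 ↗ ⋯` is a Plancherel growth process: the probability of any prescribed
initial path `∅ = μ⁽⁰⁾ ↗ μ⁽¹⁾ ↗ ⋯ ↗ μ⁽ⁿ⁾` in the Young graph equals `d_{μ⁽ⁿ⁾} / n!`,
which characterizes the distribution of the sequence of RSK shapes of an i.i.d. uniform
sequence. -/
def IsPlancherelGrowthProcess {Ω : Type*} [MeasurableSpace Ω] (P : Measure Ω)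
    (lam : ℕ → Ω → YoungDiagram) : Prop :=
  IsProbabilityMeasure P ∧
  (∀ (n : ℕ) (y : YoungDiagram), MeasurableSet {ω | lam n ω = y}) ∧
  ∀ (n : ℕ) (path : ℕ → YoungDiagram), path 0 = ⊥ →
    (∀ i, i < n → path i ≤ path (i + 1) ∧ (path (i + 1)).card = (path i).card + 1) →
    P {ω | ∀ i ≤ n, lam i ω = path i} =
      (sytCount (path n) : ENNReal) / (Nat.factorial n : ENNReal)

/-- The event `E_r⁽ⁿ⁺¹⁾` that the box added in step `n+1` of the growth process
(i.e. the unique box of `λ⁽ⁿ⁺¹⁾ ∖ λ⁽ⁿ⁾`) lies in the row with index `r`. -/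
def growthEvent {Ω : Type*} (lam : ℕ → Ω → YoungDiagram) (n r : ℕ) : Set Ω :=
  {ω | (lam (n + 1) ω).rowLen r = (lam n ω).rowLen r + 1}

/-- The Plancherel measure `Pl_n` on Young diagrams with `n` boxes: the probability of a
diagram `μ` with `μ.card = n` is `d_μ² / n!` (and `0` for diagrams with `μ.card ≠ n`). -/
noncomputable def plancherelProb (n : ℕ) (μ : YoungDiagram) : ℝ :=
  if μ.card = n then (sytCount μ : ℝ) ^ 2 / (Nat.factorial n : ℝ) else 0

namespace PlGrowth

lemma finite_card (n : ℕ) : {μ : YoungDiagram | μ.card = n}.Finite := by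
  classical
  have : Set.Finite ((fun μ : YoungDiagram => μ.cells) ⁻¹'
      (↑((Finset.range n ×ˢ Finset.range n).powerset) : Set (Finset (ℕ × ℕ)))) := by
    apply Set.Finite.preimage
    · intro a _ b _ h
      exact YoungDiagram.ext h
    · exact Finset.finite_toSet _
  refine this.subset ?_
  intro μ hμ
  simp only [Set.mem_preimage, Finset.coe_powerset, Set.mem_powerset_iff, Finset.coe_subset]
  intro c hc
  obtain ⟨i, j⟩ := c
  have hμ' : μ.cells.card = n := hμ
  simp only [Finset.mem_product, Finset.mem_range]
  constructor
  · have h1 : i < μ.colLen j := YoungDiagram.mem_iff_lt_colLen.1 hc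
    have h2 : (μ.col j).card ≤ μ.cells.card := Finset.card_le_card (Finset.filter_subset _ _)
    rw [← YoungDiagram.colLen_eq_card] at h2
    omega
  · have h1 : j < μ.rowLen i := YoungDiagram.mem_iff_lt_rowLen.1 hc
    have h2 : (μ.row i).card ≤ μ.cells.card := Finset.card_le_card (Finset.filter_subset _ _)
    rw [← YoungDiagram.rowLen_eq_card] at h2
    omega

noncomputable def Yn (n : ℕ) : Finset YoungDiagram := (finite_card n).toFinset

@[simp] lemma mem_Yn {n : ℕ} {μ : YoungDiagram} : μ ∈ Yn n ↔ μ.card = n := by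
  simp [Yn]

open scoped Classical in
noncomputable def up (ν : YoungDiagram) : Finset YoungDiagram :=
  (Yn (ν.card + 1)).filter (fun μ => ν ≤ μ)

open scoped Classical in
noncomputable def dn (μ : YoungDiagram) : Finset YoungDiagram :=
  (Yn (μ.card - 1)).filter (fun ν => ν ≤ μ ∧ ν.card + 1 = μ.card)

lemma mem_up {ν μ : YoungDiagram} : μ ∈ up ν ↔ ν ≤ μ ∧ μ.card = ν.card + 1 := by
  simp [up]; tauto

lemma mem_dn {ν μ : YoungDiagram} : ν ∈ dn μ ↔ ν ≤ μ ∧ μ.card = ν.card + 1 := by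
  simp only [dn, Finset.mem_filter, mem_Yn]
  constructor
  · rintro ⟨_, h, h'⟩; exact ⟨h, h'.symm⟩
  · rintro ⟨h, h'⟩; exact ⟨by omega, h, h'.symm⟩

lemma sum_up_dn (n : ℕ) (F : YoungDiagram → YoungDiagram → ℝ) :
    ∑ ν ∈ Yn n, ∑ μ ∈ up ν, F ν μ = ∑ μ ∈ Yn (n + 1), ∑ ν ∈ dn μ, F ν μ := by
  apply Finset.sum_comm'
  intro x y
  simp only [mem_Yn, mem_up, mem_dn]
  constructor
  · rintro ⟨rfl, h, h'⟩; exact ⟨⟨h, h'⟩, h'⟩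
  · rintro ⟨⟨h, h'⟩, h2⟩; exact ⟨by omega, h, h'⟩

noncomputable def val (g : ℕ × ℕ → ℝ) (μ : YoungDiagram) : ℝ := ∑ c ∈ μ.cells, g c

lemma val_sup_inf (g : ℕ × ℕ → ℝ) (μ ν : YoungDiagram) :
    val g (μ ⊔ ν) + val g (μ ⊓ ν) = val g μ + val g ν := by
  simp [val, Finset.sum_union_inter]

lemma card_sup_inf (μ ν : YoungDiagram) :
    (μ ⊔ ν).card + (μ ⊓ ν).card = μ.card + ν.card := by
  simp [YoungDiagram.card, Finset.card_union_add_card_inter]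

lemma eq_of_le_card {μ ν : YoungDiagram} (h : μ ≤ ν) (hc : ν.card ≤ μ.card) : μ = ν :=
  YoungDiagram.ext (Finset.eq_of_subset_of_card_le (YoungDiagram.cells_subset_iff.2 h) hc)

noncomputable def MM (g : ℕ × ℕ → ℝ) (ν : YoungDiagram) : ℝ :=
  ∑ μ ∈ up ν, (val g μ - val g ν) - ∑ κ ∈ dn ν, (val g ν - val g κ)

lemma commutation (g : ℕ × ℕ → ℝ) (f : YoungDiagram → ℝ) (ν : YoungDiagram) :
    ∑ μ ∈ up ν, ∑ ν' ∈ dn μ, (val g μ - val g ν) * f ν' =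
      MM g ν * f ν + ∑ κ ∈ dn ν, ∑ ν' ∈ up κ, (val g ν' - val g κ) * f ν' := by
  classical
  have e1 : ∀ μ ∈ up ν, ∑ ν' ∈ dn μ, (val g μ - val g ν) * f ν' =
      (val g μ - val g ν) * f ν + ∑ ν' ∈ (dn μ).erase ν, (val g μ - val g ν) * f ν' := by
    intro μ hμ
    rw [Finset.add_sum_erase _ (fun ν' => (val g μ - val g ν) * f ν')]
    exact mem_dn.2 (mem_up.1 hμ)
  have e2 : ∀ κ ∈ dn ν, ∑ ν' ∈ up κ, (val g ν' - val g κ) * f ν' =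
      (val g ν - val g κ) * f ν + ∑ ν' ∈ (up κ).erase ν, (val g ν' - val g κ) * f ν' := by
    intro κ hκ
    rw [Finset.add_sum_erase _ (fun ν' => (val g ν' - val g κ) * f ν')]
    exact mem_up.2 (mem_dn.1 hκ)
  rw [Finset.sum_congr rfl e1, Finset.sum_congr rfl e2, Finset.sum_add_distrib,
    Finset.sum_add_distrib, ← Finset.sum_mul, ← Finset.sum_mul]
  have key : ∑ μ ∈ up ν, ∑ ν' ∈ (dn μ).erase ν, (val g μ - val g ν) * f ν' =
      ∑ κ ∈ dn ν, ∑ ν' ∈ (up κ).erase ν, (val g ν' - val g κ) * f ν' := by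
    rw [Finset.sum_sigma', Finset.sum_sigma']
    have A : ∀ μ ν' : YoungDiagram, μ ∈ up ν → ν' ∈ (dn μ).erase ν →
        ν ⊔ ν' = μ ∧ (ν ⊓ ν').card + 1 = ν.card ∧ ν'.card = ν.card := by
      intro μ ν' hμ hν'
      rw [Finset.mem_erase, mem_dn] at hν'
      rw [mem_up] at hμ
      obtain ⟨hne, hle, hc⟩ := hν'
      have hs : ν ⊔ ν' ≤ μ := sup_le hμ.1 hle
      have h1 : ν.card < (ν ⊔ ν').card := by
        by_contra hcon
        have e : ν = ν ⊔ ν' := eq_of_le_card le_sup_left (by omega)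
        have : ν' ≤ ν := by rw [e]; exact le_sup_right
        exact hne (eq_of_le_card this (by omega))
      have h2 : ν ⊔ ν' = μ := eq_of_le_card hs (by omega)
      have h3 := card_sup_inf ν ν'
      rw [h2] at h3
      exact ⟨h2, by omega, by omega⟩
    have B : ∀ κ ν' : YoungDiagram, κ ∈ dn ν → ν' ∈ (up κ).erase ν →
        ν ⊓ ν' = κ ∧ (ν ⊔ ν').card = ν.card + 1 ∧ ν'.card = ν.card := by
      intro κ ν' hκ hν'
      rw [Finset.mem_erase, mem_up] at hν'
      rw [mem_dn] at hκ
      obtain ⟨hne, hle, hc⟩ := hν'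
      have hs : κ ≤ ν ⊓ ν' := le_inf hκ.1 hle
      have h1 : (ν ⊓ ν').card < ν.card := by
        by_contra hcon
        have e : ν ⊓ ν' = ν := eq_of_le_card inf_le_left (by omega)
        have : ν ≤ ν' := by rw [← e]; exact inf_le_right
        exact hne (eq_of_le_card this (by omega)).symm
      have h2 : κ = ν ⊓ ν' := eq_of_le_card hs (by omega)
      have h3 := card_sup_inf ν ν'
      rw [← h2] at h3
      exact ⟨h2.symm, by omega, by omega⟩
    refine Finset.sum_bij' (fun x _ => ⟨ν ⊓ x.2, x.2⟩) (fun x _ => ⟨ν ⊔ x.2, x.2⟩) ?_ ?_ ?_ ?_ ?_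
    · rintro ⟨μ, ν'⟩ h
      obtain ⟨h1, h2⟩ := Finset.mem_sigma.1 h
      obtain ⟨a, b, c⟩ := A μ ν' h1 h2
      refine Finset.mem_sigma.2 ⟨mem_dn.2 ⟨inf_le_left, by dsimp only at *; omega⟩, Finset.mem_erase.2 ⟨(Finset.mem_erase.1 h2).1, mem_up.2 ⟨inf_le_right, ?_⟩⟩⟩
      dsimp only at *; omega
    · rintro ⟨κ, ν'⟩ h
      obtain ⟨h1, h2⟩ := Finset.mem_sigma.1 h
      obtain ⟨a, b, c⟩ := B κ ν' h1 h2
      refine Finset.mem_sigma.2 ⟨mem_up.2 ⟨le_sup_left, by dsimp only at *; omega⟩, Finset.mem_erase.2 ⟨(Finset.mem_erase.1 h2).1, mem_dn.2 ⟨le_sup_right, ?_⟩⟩⟩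
      dsimp only at *; omega
    · rintro ⟨μ, ν'⟩ h
      obtain ⟨h1, h2⟩ := Finset.mem_sigma.1 h
      obtain ⟨a, b, c⟩ := A μ ν' h1 h2
      dsimp only at *; rw [a]
    · rintro ⟨κ, ν'⟩ h
      obtain ⟨h1, h2⟩ := Finset.mem_sigma.1 h
      obtain ⟨a, b, c⟩ := B κ ν' h1 h2
      dsimp only at *; rw [a]
    · rintro ⟨μ, ν'⟩ h
      obtain ⟨h1, h2⟩ := Finset.mem_sigma.1 h
      obtain ⟨a, b, c⟩ := A μ ν' h1 h2
      dsimp only at *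
      have := val_sup_inf g ν ν'
      rw [a] at this
      have e : val g μ - val g ν = val g ν' - val g (ν ⊓ ν') := by linarith
      rw [e]
  rw [key, MM]; ring

end PlGrowth

namespace PlGrowth

lemma rowLen_zero {ν : YoungDiagram} {j : ℕ} (h : ν.card ≤ j) : ν.rowLen j = 0 := by
  by_contra hne
  have h1 : (j, 0) ∈ ν := YoungDiagram.mem_iff_lt_rowLen.2 (Nat.pos_of_ne_zero hne)
  have h2 : j < ν.colLen 0 := YoungDiagram.mem_iff_lt_colLen.1 h1
  have h3 : (ν.col 0).card ≤ ν.cells.card := Finset.card_le_card (Finset.filter_subset _ _)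
  rw [← YoungDiagram.colLen_eq_card] at h3
  have : ν.cells.card = ν.card := rfl
  omega

lemma exists_box {ν μ : YoungDiagram} (h : ν ≤ μ) (hc : μ.card = ν.card + 1) :
    ∃ j, μ.cells = insert (j, ν.rowLen j) ν.cells ∧ (j, ν.rowLen j) ∉ ν.cells ∧
      (j = 0 ∨ ν.rowLen j < ν.rowLen (j - 1)) ∧ ν.rowLen j + 1 = μ.rowLen j ∧
      μ.rowLen (j + 1) < μ.rowLen j := by
  classical
  have hs := YoungDiagram.cells_subset_iff.2 h
  have h1 : (μ.cells \ ν.cells).card = 1 := by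
    rw [Finset.card_sdiff_of_subset hs]
    have : μ.cells.card = ν.cells.card + 1 := hc
    omega
  obtain ⟨⟨j, k⟩, hb⟩ := Finset.card_eq_one.1 h1
  have hbm : (j, k) ∈ μ.cells \ ν.cells := by rw [hb]; simp
  rw [Finset.mem_sdiff] at hbm
  have hins : μ.cells = insert (j, k) ν.cells := by
    rw [Finset.insert_eq, ← hb, Finset.sdiff_union_of_subset hs]
  have key : ∀ c ∈ μ, c ∉ ν → c = (j, k) := by
    intro c hcμ hcν
    have : c ∈ μ.cells \ ν.cells := Finset.mem_sdiff.2 ⟨hcμ, hcν⟩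
    rw [hb] at this; simpa using this
  have hjk : k < μ.rowLen j := YoungDiagram.mem_iff_lt_rowLen.1 hbm.1
  have hjk' : ν.rowLen j ≤ k := by
    by_contra hcon
    exact hbm.2 (YoungDiagram.mem_iff_lt_rowLen.2 (by omega))
  have hk : k = ν.rowLen j := by
    by_contra hne
    have h2 : (j, ν.rowLen j) ∈ μ := YoungDiagram.mem_iff_lt_rowLen.2 (by omega)
    have h3 := key _ h2 (by rw [YoungDiagram.mem_iff_lt_rowLen]; omega)
    simp at h3; omega
  subst hk
  refine ⟨j, hins, hbm.2, ?_, ?_, ?_⟩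
  · rcases Nat.eq_zero_or_pos j with h0 | h0
    · exact Or.inl h0
    · right
      by_contra hcon
      have h2 : (j - 1, ν.rowLen j) ∈ μ := μ.up_left_mem (by omega) le_rfl hbm.1
      have h3 := key _ h2 (by rw [YoungDiagram.mem_iff_lt_rowLen]; omega)
      simp at h3; omega
  · by_contra hne
    have h2 : (j, ν.rowLen j + 1) ∈ μ := YoungDiagram.mem_iff_lt_rowLen.2 (by omega)
    have h3 := key _ h2 (by rw [YoungDiagram.mem_iff_lt_rowLen]; omega)
    simp at h3
  · by_contra hcon
    have h2 : (j + 1, ν.rowLen j) ∈ μ := YoungDiagram.mem_iff_lt_rowLen.2 (by omega)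
    have h4 := ν.rowLen_anti j (j + 1) (by omega)
    have h3 := key _ h2 (by rw [YoungDiagram.mem_iff_lt_rowLen]; omega)
    simp at h3

lemma val_box {g : ℕ × ℕ → ℝ} {ν μ : YoungDiagram} {b : ℕ × ℕ}
    (h : μ.cells = insert b ν.cells) (hb : b ∉ ν.cells) : val g μ - val g ν = g b := by
  simp only [val]
  rw [h, Finset.sum_insert hb]; ring

def addBox (ν : YoungDiagram) (j : ℕ) (h : j = 0 ∨ ν.rowLen j < ν.rowLen (j - 1)) :
    YoungDiagram where
  cells := insert (j, ν.rowLen j) ν.cells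
  isLowerSet := by
    rintro ⟨a, b⟩ ⟨c, d⟩ hle hm
    obtain ⟨h1, h2⟩ := Prod.mk_le_mk.1 hle
    simp only [Finset.coe_insert, Set.mem_insert_iff, Prod.mk.injEq, Finset.mem_coe,
      YoungDiagram.mem_cells] at hm ⊢
    rcases hm with ⟨rfl, rfl⟩ | hm
    · by_cases hc : c = a
      · subst hc
        by_cases hd : d = ν.rowLen c
        · left; exact ⟨rfl, hd⟩
        · right; rw [YoungDiagram.mem_iff_lt_rowLen]; omega
      · right
        rw [YoungDiagram.mem_iff_lt_rowLen]
        have := ν.rowLen_anti c (a - 1) (by omega)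
        omega
    · right; exact ν.up_left_mem h1 h2 hm

def remBox (ν : YoungDiagram) (j : ℕ) (h : ν.rowLen (j + 1) < ν.rowLen j) :
    YoungDiagram where
  cells := ν.cells.erase (j, ν.rowLen j - 1)
  isLowerSet := by
    rintro ⟨a, b⟩ ⟨c, d⟩ hle hm
    obtain ⟨h1, h2⟩ := Prod.mk_le_mk.1 hle
    simp only [Finset.coe_erase, Set.mem_sdiff, Finset.mem_coe, Set.mem_singleton_iff,
      YoungDiagram.mem_cells, Prod.mk.injEq] at hm ⊢
    refine ⟨ν.up_left_mem h1 h2 hm.1, ?_⟩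
    rintro ⟨rfl, rfl⟩
    apply hm.2
    have h3 := YoungDiagram.mem_iff_lt_rowLen.1 hm.1
    have : a = c := by
      by_contra hne
      have := ν.rowLen_anti (c + 1) a (by omega)
      omega
    subst this
    exact ⟨rfl, by omega⟩

lemma sum_up_rows (g : ℕ × ℕ → ℝ) (ν : YoungDiagram) :
    ∑ μ ∈ up ν, (val g μ - val g ν) =
      ∑ j ∈ (Finset.range (ν.card + 1)).filter (fun j => j = 0 ∨ ν.rowLen j < ν.rowLen (j - 1)),
        g (j, ν.rowLen j) := by
  symm
  have nm : ∀ j, (j, ν.rowLen j) ∉ ν.cells := by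
    intro j
    rw [YoungDiagram.mem_cells, YoungDiagram.mem_iff_lt_rowLen]; omega
  refine Finset.sum_bij (fun j hj => addBox ν j (Finset.mem_filter.1 hj).2) ?_ ?_ ?_ ?_
  · intro j hj
    rw [mem_up]
    constructor
    · rw [← YoungDiagram.cells_subset_iff]; exact Finset.subset_insert _ _
    · show (insert (j, ν.rowLen j) ν.cells).card = _
      rw [Finset.card_insert_of_notMem (nm j)]
  · intro a ha b hb hab
    have h1 : insert (a, ν.rowLen a) ν.cells = insert (b, ν.rowLen b) ν.cells :=
      congrArg YoungDiagram.cells hab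
    have h2 : (a, ν.rowLen a) ∈ insert (b, ν.rowLen b) ν.cells := by
      rw [← h1]; exact Finset.mem_insert_self _ _
    rcases Finset.mem_insert.1 h2 with h3 | h3
    · exact congrArg Prod.fst h3
    · exact absurd h3 (nm a)
  · intro μ hμ
    obtain ⟨h, hc⟩ := mem_up.1 hμ
    obtain ⟨j, h1, h2, h3, h4, h5⟩ := exists_box h hc
    refine ⟨j, ?_, ?_⟩
    · refine Finset.mem_filter.2 ⟨?_, h3⟩
      rw [Finset.mem_range]
      by_contra hcon
      have := rowLen_zero (ν := ν) (j := j - 1) (by omega)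
      omega
    · exact YoungDiagram.ext h1.symm
  · intro j hj
    exact (val_box (ν := ν) rfl (nm j)).symm

lemma sum_dn_rows (g : ℕ × ℕ → ℝ) (ν : YoungDiagram) :
    ∑ κ ∈ dn ν, (val g ν - val g κ) =
      ∑ j ∈ (Finset.range ν.card).filter (fun j => ν.rowLen (j + 1) < ν.rowLen j),
        g (j, ν.rowLen j - 1) := by
  symm
  have nm : ∀ j, ν.rowLen (j + 1) < ν.rowLen j → (j, ν.rowLen j - 1) ∈ ν.cells := by
    intro j hj
    rw [YoungDiagram.mem_cells, YoungDiagram.mem_iff_lt_rowLen]; omega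
  refine Finset.sum_bij (fun j hj => remBox ν j (Finset.mem_filter.1 hj).2) ?_ ?_ ?_ ?_
  · intro j hj
    have hj' := (Finset.mem_filter.1 hj).2
    rw [mem_dn]
    constructor
    · rw [← YoungDiagram.cells_subset_iff]; exact Finset.erase_subset _ _
    · show _ = (ν.cells.erase (j, ν.rowLen j - 1)).card + 1
      rw [Finset.card_erase_add_one (nm j hj')]
  · intro a ha b hb hab
    have ha' := nm a (Finset.mem_filter.1 ha).2
    have h1 : ν.cells.erase (a, ν.rowLen a - 1) = ν.cells.erase (b, ν.rowLen b - 1) :=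
      congrArg YoungDiagram.cells hab
    by_contra hne
    have h2 : (a, ν.rowLen a - 1) ∈ ν.cells.erase (b, ν.rowLen b - 1) :=
      Finset.mem_erase.2 ⟨by simp [hne], ha'⟩
    rw [← h1] at h2
    simp at h2
  · intro κ hκ
    obtain ⟨h, hc⟩ := mem_dn.1 hκ
    obtain ⟨j, h1, h2, h3, h4, h5⟩ := exists_box h hc
    refine ⟨j, ?_, ?_⟩
    · refine Finset.mem_filter.2 ⟨?_, h5⟩
      rw [Finset.mem_range]
      by_contra hcon
      have := rowLen_zero (ν := ν) (j := j) (by omega)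
      omega
    · apply YoungDiagram.ext
      show ν.cells.erase (j, ν.rowLen j - 1) = κ.cells
      rw [← h4, h1]
      simpa using h2
  · intro j hj
    have hj' := nm j (Finset.mem_filter.1 hj).2
    refine (val_box (μ := ν) ?_ ?_).symm
    · exact (Finset.insert_erase hj').symm
    · simp [remBox]

lemma MM_rows (g : ℕ × ℕ → ℝ) (ν : YoungDiagram) :
    MM g ν = g (0, ν.rowLen 0) + ∑ j ∈ Finset.range ν.card,
      if ν.rowLen (j + 1) < ν.rowLen j then
        g (j + 1, ν.rowLen (j + 1)) - g (j, ν.rowLen j - 1) else 0 := by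
  rw [MM, sum_up_rows, sum_dn_rows, Finset.sum_filter, Finset.sum_filter,
    Finset.sum_range_succ']
  simp only [Nat.add_eq_zero_iff, one_ne_zero, and_false, false_or, Nat.add_sub_cancel, true_or,
    if_true]
  rw [add_sub_right_comm, ← Finset.sum_sub_distrib, add_comm]
  congr 1
  apply Finset.sum_congr rfl
  intro j _
  split_ifs <;> simp

lemma val_rows (g : ℕ × ℕ → ℝ) (ν : YoungDiagram) :
    val g ν = ∑ j ∈ Finset.range ν.card, ∑ k ∈ Finset.range (ν.rowLen j), g (j, k) := by
  classical
  rw [val, ← Finset.sum_fiberwise_of_maps_to (s := ν.cells) (t := Finset.range ν.card)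
    (g := Prod.fst)]
  · apply Finset.sum_congr rfl
    intro j _
    have : ν.cells.filter (fun c => c.1 = j) = {j} ×ˢ Finset.range (ν.rowLen j) :=
      YoungDiagram.row_eq_prod
    rw [this, Finset.sum_product]
    simp
  · rintro ⟨j, k⟩ h
    rw [Finset.mem_range]
    by_contra hcon
    have := YoungDiagram.mem_iff_lt_rowLen.1 h
    rw [rowLen_zero (by simpa using hcon)] at this
    omega

def content (c : ℕ × ℕ) : ℤ := (c.2 : ℤ) - c.1

lemma MM_content (h : ℤ → ℝ) (ν : YoungDiagram) :
    MM (fun c => h (content c)) ν =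
      h 0 + val (fun c => h (content c + 1) + h (content c - 1) - 2 * h (content c)) ν := by
  have tel : ∀ (j m : ℕ), ∑ k ∈ Finset.range m, (h (content (j, k) + 1) + h (content (j, k) - 1)
      - 2 * h (content (j, k))) =
      h ((m : ℤ) - j) - h ((m : ℤ) - j - 1) - (h (-(j : ℤ)) - h (-((j + 1 : ℕ) : ℤ))) := by
    intro j m
    induction m with
    | zero => 
      have e : (((0 : ℕ) : ℤ) - j - 1) = -((j + 1 : ℕ) : ℤ) := by push_cast; ring
      rw [e]; simp
    | succ m ih =>
      rw [Finset.sum_range_succ, ih]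
      simp only [content]
      have e1 : ((m + 1 : ℕ) : ℤ) - j = m - j + 1 := by push_cast; ring
      rw [e1, add_sub_cancel_right]
      ring
  rw [MM_rows, val_rows]
  simp only [tel]
  rw [Finset.sum_sub_distrib, Finset.sum_range_sub' (fun j : ℕ => h (-(j : ℤ)))]
  have e : ∀ j ∈ Finset.range ν.card, (if ν.rowLen (j + 1) < ν.rowLen j then
        h (content (j + 1, ν.rowLen (j + 1))) - h (content (j, ν.rowLen j - 1)) else 0) =
      (h (content (j + 1, ν.rowLen (j + 1))) - h (content (j, ν.rowLen j))) +
      (h ((ν.rowLen j : ℤ) - j) - h ((ν.rowLen j : ℤ) - j - 1)) := by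
    intro j _
    split_ifs with hh
    · have : content (j, ν.rowLen j - 1) = (ν.rowLen j : ℤ) - j - 1 := by
        simp only [content]; omega
      rw [this]; simp only [content]; ring
    · have hle := ν.rowLen_anti j (j + 1) (by omega)
      have : content (j + 1, ν.rowLen (j + 1)) = (ν.rowLen j : ℤ) - j - 1 := by
        simp only [content]; omega
      rw [this]; simp only [content]; ring
  rw [Finset.sum_congr rfl e, Finset.sum_add_distrib,
    Finset.sum_range_sub (fun j => h (content (j, ν.rowLen j)))]
  rw [rowLen_zero (le_refl ν.card)]
  simp [content]
  ring

lemma MM_one (ν : YoungDiagram) : MM (fun _ => 1) ν = 1 := by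
  have := MM_content (fun _ => 1) ν
  rw [this]; simp [val]; ring

lemma MM_row_nonneg (r : ℕ) (ν : YoungDiagram) :
    0 ≤ MM (fun c => if c.1 ≤ r then 1 else 0) ν := by
  rw [MM_rows]
  have : ∀ N, -1 ≤ ∑ j ∈ Finset.range N,
      (if ν.rowLen (j + 1) < ν.rowLen j then
        (if j + 1 ≤ r then (1 : ℝ) else 0) - (if j ≤ r then 1 else 0) else 0) ∧
      (N ≤ r → 0 ≤ ∑ j ∈ Finset.range N,
      (if ν.rowLen (j + 1) < ν.rowLen j then
        (if j + 1 ≤ r then (1 : ℝ) else 0) - (if j ≤ r then 1 else 0) else 0)) := by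
    intro N
    induction N with
    | zero => simp
    | succ N ih =>
      rw [Finset.sum_range_succ]
      rcases lt_trichotomy N r with h | h | h
      · have h1 : N + 1 ≤ r := h
        have := ih.2 h.le
        simp only [h1, h.le, if_true, sub_self, ite_self, add_zero]
        exact ⟨ih.1, fun _ => this⟩
      · subst h
        have := ih.2 le_rfl
        refine ⟨?_, fun h => by omega⟩
        simp only [le_refl, if_true]
        split_ifs <;> first | omega | linarith
      · have h1 : ¬ (N + 1 ≤ r) := by omega
        have h2 : ¬ (N ≤ r) := by omega
        simp only [h1, h2, if_false, sub_self, ite_self, add_zero]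
        exact ⟨ih.1, fun h => by exact h.elim⟩
  have := (this ν.card).1
  simp only [Nat.zero_le, if_true]
  linarith

lemma val_row (r : ℕ) (ν : YoungDiagram) :
    val (fun c => if c.1 = r then 1 else 0) ν = ν.rowLen r := by
  classical
  rw [val, Finset.sum_boole, YoungDiagram.rowLen_eq_card]
  rfl

end PlGrowth

namespace PlGrowth

/-- Standard fillings as functions on all of `ℕ × ℕ`. -/
def SS (μ : YoungDiagram) : Set (ℕ × ℕ → ℕ) :=
  {T | (∀ c, c ∉ μ → T c = 0) ∧ (∀ c ∈ μ, T c < μ.card) ∧ 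
    (∀ a ∈ μ, ∀ b ∈ μ, T a = T b → a = b) ∧
    ∀ a ∈ μ, ∀ b ∈ μ, a.1 ≤ b.1 → a.2 ≤ b.2 → a ≠ b → T a < T b}

lemma sytCount_eq (μ : YoungDiagram) : sytCount μ = Nat.card (SS μ) := by
  classical
  unfold sytCount
  apply Nat.card_congr
  refine ⟨fun T => ⟨fun c => if h : c ∈ μ.cells then (T.1 ⟨c, h⟩ : ℕ) else 0, ?_⟩,
    fun T => ⟨fun c => ⟨T.1 c, T.2.2.1 c c.2⟩, ?_⟩, ?_, ?_⟩
  · obtain ⟨T, hT, hm⟩ := T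
    refine ⟨?_, ?_, ?_, ?_⟩
    · intro c hc
      have : c ∉ μ.cells := hc
      simp [this]
    · intro c hc
      have : c ∈ μ.cells := hc
      simp only [this, dite_true]
      exact (T ⟨c, this⟩).2
    · intro a ha b hb hab
      have ha' : a ∈ μ.cells := ha
      have hb' : b ∈ μ.cells := hb
      simp only [ha', hb', dite_true] at hab
      have := hT.1 (Fin.ext hab)
      exact congrArg Subtype.val this
    · intro a ha b hb h1 h2 hne
      have ha' : a ∈ μ.cells := ha
      have hb' : b ∈ μ.cells := hb
      simp only [ha', hb', dite_true]
      exact hm ⟨a, ha'⟩ ⟨b, hb'⟩ h1 h2 (by simpa using hne)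
  · obtain ⟨T, h0, h1, h2, h3⟩ := T
    refine ⟨?_, ?_⟩
    · rw [Fintype.bijective_iff_injective_and_card]
      constructor
      · intro a b hab
        apply Subtype.ext
        exact h2 a a.2 b b.2 (by simpa using hab)
      · simp [YoungDiagram.card]
    · intro a b ha hb hne
      exact h3 a a.2 b b.2 ha hb (fun h => hne (Subtype.ext h))
  · rintro ⟨T, hT, hm⟩
    apply Subtype.ext
    funext c
    apply Fin.ext
    simp
  · rintro ⟨T, h0, h1, h2, h3⟩
    apply Subtype.ext
    funext c
    by_cases hc : c ∈ μ.cells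
    · simp [hc]
    · simp [hc]
      exact (h0 c hc).symm

instance finite_SS (μ : YoungDiagram) : Finite (SS μ) := by
  classical
  have : Function.Injective (fun T : SS μ => (fun c : μ.cells => (⟨T.1 c, T.2.2.1 c c.2⟩ : Fin μ.card))) := by
    rintro ⟨T, h0, h1, h2, h3⟩ ⟨T', h0', h1', h2', h3'⟩ h
    apply Subtype.ext
    funext c
    by_cases hc : c ∈ μ.cells
    · have := congrArg Fin.val (congrFun h ⟨c, hc⟩)
      simpa using this
    · show T c = T' c
      rw [h0 c hc, h0' c hc]
  exact Finite.of_injective _ this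

lemma sytCount_bot : sytCount ⊥ = 1 := by
  rw [sytCount_eq, Nat.card_eq_one_iff_unique]
  constructor
  · constructor
    rintro ⟨T, h0, -⟩ ⟨T', h0', -⟩
    apply Subtype.ext; funext c
    show T c = T' c
    rw [h0 c (by simp), h0' c (by simp)]
  · exact ⟨⟨fun _ => 0, by simp, by simp, by simp, by simp⟩⟩

/-- the subdiagram of small entries -/
def subD (μ : YoungDiagram) (T : ℕ × ℕ → ℕ)
    (hT : T ∈ SS μ) : YoungDiagram where
  cells := μ.cells.filter (fun c => T c + 1 < μ.card)
  isLowerSet := by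
    rintro a b hle hm
    simp only [Finset.coe_filter, YoungDiagram.mem_cells, Set.mem_ofPred_eq] at hm ⊢
    obtain ⟨h1, h2⟩ := hm
    have hb : b ∈ μ := μ.up_left_mem hle.1 hle.2 h1
    refine ⟨hb, ?_⟩
    by_cases hne : b = a
    · rw [hne]; exact h2
    · have := hT.2.2.2 b hb a h1 hle.1 hle.2 hne
      omega

lemma image_SS {μ : YoungDiagram} {T : ℕ × ℕ → ℕ} (hT : T ∈ SS μ) :
    μ.cells.image T = Finset.range μ.card := by
  apply Finset.eq_of_subset_of_card_le
  · intro x hx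
    obtain ⟨c, hc, rfl⟩ := Finset.mem_image.1 hx
    exact Finset.mem_range.2 (hT.2.1 c hc)
  · rw [Finset.card_image_of_injOn, Finset.card_range]
    intro a ha b hb hab
    exact hT.2.2.1 a ha b hb hab

lemma subD_mem {μ : YoungDiagram} (T : ℕ × ℕ → ℕ) (hT : T ∈ SS μ) (hpos : 0 < μ.card) :
    subD μ T hT ∈ dn μ := by
  rw [mem_dn]
  constructor
  · rw [← YoungDiagram.cells_subset_iff]; exact Finset.filter_subset _ _
  · have h := image_SS hT
    have hm : μ.card - 1 ∈ μ.cells.image T := by rw [h, Finset.mem_range]; omega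
    obtain ⟨c, hc, hTc⟩ := Finset.mem_image.1 hm
    have e : (μ.cells.filter (fun c => T c + 1 < μ.card)) = μ.cells.erase c := by
      ext x
      simp only [Finset.mem_filter, Finset.mem_erase]
      constructor
      · rintro ⟨h1, h2⟩
        refine ⟨?_, h1⟩
        rintro rfl; omega
      · rintro ⟨h1, h2⟩
        refine ⟨h2, ?_⟩
        have h3 := hT.2.1 x h2
        have h4 : T x ≠ T c := fun h => h1 (hT.2.2.1 x h2 c hc h)
        omega
    show μ.cells.card = (μ.cells.filter (fun c => T c + 1 < μ.card)).card + 1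
    rw [e, Finset.card_erase_add_one hc]

open scoped Classical in
lemma fiber_card {μ ν : YoungDiagram} (hν : ν ∈ dn μ) :
    Nat.card {T : SS μ // subD μ T.1 T.2 = ν} = Nat.card (SS ν) := by
  obtain ⟨hle, hc⟩ := mem_dn.1 hν
  obtain ⟨j, hins, hnm, -, hr, hcor⟩ := exists_box hle hc
  set b : ℕ × ℕ := (j, ν.rowLen j) with hb
  have hbμ : b ∈ μ := by
    rw [← YoungDiagram.mem_cells, hins]; exact Finset.mem_insert_self _ _
  have hbν : b ∉ ν := hnm
  have hsub : ∀ c, c ∈ ν → c ∈ μ := fun c h => hle h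
  have hmem : ∀ c, c ∈ μ → c ≠ b → c ∈ ν := by
    intro c h hne
    rw [← YoungDiagram.mem_cells, hins, Finset.mem_insert] at h
    exact h.resolve_left hne
  apply Nat.card_congr
  refine ⟨fun T => ⟨fun c => if c ∈ ν then T.1.1 c else 0, ?_⟩,
    fun T => ⟨⟨fun c => if c = b then ν.card else T.1 c, ?_⟩, ?_⟩, ?_, ?_⟩
  · obtain ⟨⟨T, hT⟩, hsd⟩ := T
    have hlt : ∀ c ∈ ν, T c + 1 < μ.card := by
      intro c hcν
      have : c ∈ (subD μ T hT).cells := by rw [hsd]; exact hcν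
      exact (Finset.mem_filter.1 this).2
    refine ⟨?_, ?_, ?_, ?_⟩
    · intro c h; simp [h]
    · intro c h; have := hlt c h; simp [h]; omega
    · intro a ha c hc' h
      simp only [ha, hc', if_true] at h
      exact hT.2.2.1 a (hsub a ha) c (hsub c hc') h
    · intro a ha c hc' h1 h2 h3
      simp only [ha, hc', if_true]
      exact hT.2.2.2 a (hsub a ha) c (hsub c hc') h1 h2 h3
  · obtain ⟨T, hT⟩ := T
    refine ⟨?_, ?_, ?_, ?_⟩
    · intro c h
      have h1 : c ≠ b := by rintro rfl; exact h hbμ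
      simp only [h1, if_false]
      exact hT.1 c (fun h' => h (hsub c h'))
    · intro c h
      by_cases h1 : c = b
      · simp [h1]; omega
      · simp only [h1, if_false]
        have := hT.2.1 c (hmem c h h1); omega
    · intro a ha c hc' h
      by_cases h1 : a = b <;> by_cases h2 : c = b
      · rw [h1, h2]
      · simp only [h1, h2, if_true, if_false] at h
        have := hT.2.1 c (hmem c hc' h2); omega
      · simp only [h1, h2, if_true, if_false] at h
        have := hT.2.1 a (hmem a ha h1); omega
      · simp only [h1, h2, if_false] at h
        exact hT.2.2.1 a (hmem a ha h1) c (hmem c hc' h2) h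
    · intro a ha c hc' hh1 hh2 hne
      by_cases h1 : a = b <;> by_cases h2 : c = b
      · exact absurd (h1.trans h2.symm) hne
      · exfalso
        have hcν := hmem c hc' h2
        apply hbν
        rw [← h1]
        exact ν.up_left_mem hh1 hh2 hcν
      · simp only [h1, h2, if_true, if_false]
        exact hT.2.1 a (hmem a ha h1)
      · simp only [h1, h2, if_false]
        exact hT.2.2.2 a (hmem a ha h1) c (hmem c hc' h2) hh1 hh2 hne
  · obtain ⟨T, hT⟩ := T
    apply YoungDiagram.ext
    ext c
    show c ∈ μ.cells.filter (fun c => (if c = b then ν.card else T c) + 1 < μ.card) ↔ _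
    rw [Finset.mem_filter]
    constructor
    · rintro ⟨h1, h2⟩
      refine hmem c h1 ?_
      rintro rfl
      simp at h2; omega
    · intro h
      refine ⟨hsub c h, ?_⟩
      have h1 : c ≠ b := by rintro rfl; exact hbν h
      have := hT.2.1 c h
      simp only [h1, if_false]; omega
  · rintro ⟨⟨T, hT⟩, hsd⟩
    apply Subtype.ext
    apply Subtype.ext
    funext c
    show (if c = b then ν.card else if c ∈ ν then T c else 0) = T c
    split_ifs with h1 h2
    · subst h1
      have h3 : b ∉ (subD μ T hT).cells := by rw [hsd]; exact hbν
      have h4 : ¬ (T b + 1 < μ.card) := fun h => h3 (Finset.mem_filter.2 ⟨hbμ, h⟩)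
      have := hT.2.1 b hbμ
      omega
    · rfl
    · refine (hT.1 c ?_).symm
      intro h3
      exact h2 (hmem c h3 h1)
  · rintro ⟨T, hT⟩
    apply Subtype.ext
    funext c
    show (if c ∈ ν then (if c = b then ν.card else T c) else 0) = T c
    split_ifs with h1 h2
    · subst h2; exact absurd h1 hbν
    · rfl
    · exact (hT.1 c h1).symm

lemma sytCount_branch (μ : YoungDiagram) (hpos : 0 < μ.card) :
    sytCount μ = ∑ ν ∈ dn μ, sytCount ν := by
  classical
  rw [sytCount_eq]
  have : Fintype (SS μ) := Fintype.ofFinite _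
  rw [Nat.card_eq_fintype_card, ← Finset.card_univ,
    Finset.card_eq_sum_card_fiberwise (f := fun T : SS μ => subD μ T.1 T.2) (t := dn μ)]
  · apply Finset.sum_congr rfl
    intro ν hν
    rw [sytCount_eq, ← fiber_card hν, Nat.card_eq_fintype_card, Fintype.card_subtype]
  · intro T _
    exact subD_mem T.1 T.2 hpos

noncomputable def dd (μ : YoungDiagram) : ℝ := sytCount μ

lemma card_bot : (⊥ : YoungDiagram).card = 0 := by simp [YoungDiagram.card]

lemma Yn_zero : Yn 0 = {⊥} := by
  ext μ
  simp only [mem_Yn, Finset.mem_singleton]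
  constructor
  · intro h
    apply YoungDiagram.ext
    simpa [YoungDiagram.card] using h
  · rintro rfl; exact card_bot

lemma dd_bot : dd ⊥ = 1 := by simp [dd, sytCount_bot]

lemma dd_nonneg (μ) : 0 ≤ dd μ := by simp [dd]

lemma dd_branch {n : ℕ} {μ : YoungDiagram} (h : μ.card = n + 1) : dd μ = ∑ ν ∈ dn μ, dd ν := by
  simp only [dd]
  rw [sytCount_branch μ (by omega)]; push_cast; rfl

lemma dn_zero {μ : YoungDiagram} (h : μ.card = 0) : dn μ = ∅ := by
  ext ν; rw [mem_dn]; simp; omega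

/-- unweighted commutation -/
lemma comm_one (f : YoungDiagram → ℝ) (ν : YoungDiagram) :
    ∑ μ ∈ up ν, ∑ ν' ∈ dn μ, f ν' = f ν + ∑ κ ∈ dn ν, ∑ ν' ∈ up κ, f ν' := by
  have h := commutation (fun _ => 1) f ν
  rw [MM_one, one_mul] at h
  have e : ∀ {ν μ : YoungDiagram}, μ.card = ν.card + 1 →
      val (fun _ => (1 : ℝ)) μ - val (fun _ => 1) ν = 1 := by
    intro ν μ h
    have h1 : μ.cells.card = ν.cells.card + 1 := h
    simp [val, h1]
  convert h using 1
  · apply Finset.sum_congr rfl; intro μ hμ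
    rw [e (mem_up.1 hμ).2]; simp
  · congr 1
    apply Finset.sum_congr rfl; intro κ hκ
    apply Finset.sum_congr rfl; intro ν' hν'
    rw [e (mem_up.1 hν').2]; simp

lemma sum_up_dd (n : ℕ) : ∀ ν : YoungDiagram, ν.card = n → ∑ μ ∈ up ν, dd μ = (n + 1) * dd ν := by
  induction n with
  | zero =>
    intro ν hν
    have h1 : ∑ μ ∈ up ν, dd μ = ∑ μ ∈ up ν, ∑ ν' ∈ dn μ, dd ν' := by
      apply Finset.sum_congr rfl; intro μ hμ
      exact dd_branch (mem_up.1 hμ).2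
    rw [h1, comm_one, dn_zero hν]; simp
  | succ n ih =>
    intro ν hν
    have h1 : ∑ μ ∈ up ν, dd μ = ∑ μ ∈ up ν, ∑ ν' ∈ dn μ, dd ν' := by
      apply Finset.sum_congr rfl; intro μ hμ
      exact dd_branch (mem_up.1 hμ).2
    rw [h1, comm_one]
    have h2 : ∀ κ ∈ dn ν, ∑ ν' ∈ up κ, dd ν' = (n + 1) * dd κ := by
      intro κ hκ
      apply ih
      have := (mem_dn.1 hκ).2; omega
    rw [Finset.sum_congr rfl h2, ← Finset.mul_sum, ← dd_branch hν]
    push_cast; ring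

lemma sum_dd_sq (n : ℕ) : ∑ μ ∈ Yn n, dd μ ^ 2 = n.factorial := by
  induction n with
  | zero => simp [Yn_zero, dd_bot]
  | succ n ih =>
    have h1 : ∑ μ ∈ Yn (n + 1), dd μ ^ 2 = ∑ μ ∈ Yn (n + 1), ∑ ν ∈ dn μ, dd ν * dd μ := by
      apply Finset.sum_congr rfl; intro μ hμ
      rw [← Finset.sum_mul, ← dd_branch (mem_Yn.1 hμ)]; ring
    rw [h1, ← sum_up_dn n (fun ν μ => dd ν * dd μ)]
    have h2 : ∀ ν ∈ Yn n, ∑ μ ∈ up ν, dd ν * dd μ = (n + 1) * dd ν ^ 2 := by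
      intro ν hν
      rw [← Finset.mul_sum, sum_up_dd n ν (mem_Yn.1 hν)]; ring
    rw [Finset.sum_congr rfl h2, ← Finset.mul_sum, ih, Nat.factorial_succ]; push_cast; ring

end PlGrowth

namespace PlGrowth

noncomputable def JE (n : ℕ) (F : YoungDiagram → YoungDiagram → ℝ) : ℝ :=
  (∑ ν ∈ Yn n, ∑ μ ∈ up ν, dd ν * dd μ * F ν μ) / (n + 1).factorial

noncomputable def EE (n : ℕ) (f : YoungDiagram → ℝ) : ℝ :=
  (∑ μ ∈ Yn n, dd μ ^ 2 * f μ) / n.factorial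

noncomputable def box (g : ℕ × ℕ → ℝ) (ν μ : YoungDiagram) : ℝ := val g μ - val g ν

lemma sum_pairs_left (n : ℕ) (f : YoungDiagram → ℝ) :
    ∑ ν ∈ Yn n, ∑ μ ∈ up ν, dd ν * dd μ * f ν = (n + 1) * ∑ ν ∈ Yn n, dd ν ^ 2 * f ν := by
  rw [Finset.mul_sum]
  apply Finset.sum_congr rfl; intro ν hν
  have : ∑ μ ∈ up ν, dd ν * dd μ * f ν = (∑ μ ∈ up ν, dd μ) * (dd ν * f ν) := by
    rw [Finset.sum_mul]; apply Finset.sum_congr rfl; intro μ _; ring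
  rw [this, sum_up_dd n ν (mem_Yn.1 hν)]; ring

lemma sum_pairs_right (n : ℕ) (f : YoungDiagram → ℝ) :
    ∑ ν ∈ Yn n, ∑ μ ∈ up ν, dd ν * dd μ * f μ = ∑ μ ∈ Yn (n + 1), dd μ ^ 2 * f μ := by
  rw [sum_up_dn n (fun ν μ => dd ν * dd μ * f μ)]
  apply Finset.sum_congr rfl; intro μ hμ
  rw [← Finset.sum_mul, ← Finset.sum_mul, ← dd_branch (mem_Yn.1 hμ)]; ring

lemma fact_ne (n : ℕ) : (n.factorial : ℝ) ≠ 0 := by exact_mod_cast n.factorial_ne_zero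
lemma fact_pos' (n : ℕ) : (0 : ℝ) < (n.factorial : ℝ) := by exact_mod_cast n.factorial_pos

lemma JE_left (n : ℕ) (f : YoungDiagram → ℝ) : JE n (fun ν _ => f ν) = EE n f := by
  rw [JE, EE, sum_pairs_left, Nat.factorial_succ]
  have := fact_ne n
  push_cast
  have h : (n : ℝ) + 1 ≠ 0 := by positivity
  field_simp

lemma JE_right (n : ℕ) (f : YoungDiagram → ℝ) : JE n (fun _ μ => f μ) = EE (n + 1) f := by
  rw [JE, EE, sum_pairs_right]

lemma JE_sub (n : ℕ) (F G : YoungDiagram → YoungDiagram → ℝ) :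
    JE n (fun ν μ => F ν μ - G ν μ) = JE n F - JE n G := by
  simp only [JE, mul_sub, Finset.sum_sub_distrib, sub_div]

lemma JE_add (n : ℕ) (F G : YoungDiagram → YoungDiagram → ℝ) :
    JE n (fun ν μ => F ν μ + G ν μ) = JE n F + JE n G := by
  simp only [JE, mul_add, Finset.sum_add_distrib, add_div]

lemma JE_sum {ι : Type*} (s : Finset ι) (n : ℕ) (F : ι → YoungDiagram → YoungDiagram → ℝ) :
    JE n (fun ν μ => ∑ i ∈ s, F i ν μ) = ∑ i ∈ s, JE n (F i) := by
  classical
  induction s using Finset.induction_on with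
  | empty => simp [JE]
  | insert a s ha ih =>
    simp only [Finset.sum_insert ha]
    rw [JE_add, ih]

lemma JE_mono {n : ℕ} {F G : YoungDiagram → YoungDiagram → ℝ}
    (h : ∀ ν μ, ν.card = n → μ ∈ up ν → F ν μ ≤ G ν μ) : JE n F ≤ JE n G := by
  apply div_le_div_of_nonneg_right _ (fact_pos' _).le
  apply Finset.sum_le_sum; intro ν hν
  apply Finset.sum_le_sum; intro μ hμ
  exact mul_le_mul_of_nonneg_left (h ν μ (mem_Yn.1 hν) hμ) (mul_nonneg (dd_nonneg _) (dd_nonneg _))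

lemma JE_congr {n : ℕ} {F G : YoungDiagram → YoungDiagram → ℝ}
    (h : ∀ ν μ, ν.card = n → μ ∈ up ν → F ν μ = G ν μ) : JE n F = JE n G :=
  le_antisymm (JE_mono fun ν μ a b => (h ν μ a b).le) (JE_mono fun ν μ a b => (h ν μ a b).ge)

lemma EE_mono {n : ℕ} {f g : YoungDiagram → ℝ} (h : ∀ μ, μ.card = n → f μ ≤ g μ) :
    EE n f ≤ EE n g := by
  apply div_le_div_of_nonneg_right _ (fact_pos' _).le
  apply Finset.sum_le_sum; intro ν hν
  exact mul_le_mul_of_nonneg_left (h ν (mem_Yn.1 hν)) (sq_nonneg _)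

lemma EE_one (n : ℕ) : EE n (fun _ => 1) = 1 := by
  simp only [EE, mul_one, sum_dd_sq]
  exact div_self (fact_ne n)

lemma EE_add (n : ℕ) (f g : YoungDiagram → ℝ) :
    EE n (fun μ => f μ + g μ) = EE n f + EE n g := by
  simp only [EE, mul_add, Finset.sum_add_distrib, add_div]

lemma EE_smul (n : ℕ) (c : ℝ) (f : YoungDiagram → ℝ) :
    EE n (fun μ => c * f μ) = c * EE n f := by
  simp only [EE]
  rw [← mul_div_assoc, Finset.mul_sum]
  congr 1
  apply Finset.sum_congr rfl; intros; ring

lemma EE_const (n : ℕ) (c : ℝ) : EE n (fun _ => c) = c := by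
  have := EE_smul n c (fun _ => 1)
  rw [EE_one] at this; simpa using this

lemma EE_val_succ (n : ℕ) (g : ℕ × ℕ → ℝ) :
    EE (n + 1) (val g) = JE n (box g) + EE n (val g) := by
  have : JE n (box g) = JE n (fun _ μ => val g μ) - JE n (fun ν _ => val g ν) := by
    rw [← JE_sub]; rfl
  rw [this, JE_left, JE_right]; ring

lemma J_expand (n : ℕ) (g : ℕ × ℕ → ℝ) :
    ∑ ν ∈ Yn n, ∑ μ ∈ up ν, dd ν * dd μ * box g ν μ =
      ∑ ν ∈ Yn n, dd ν ^ 2 * MM g ν +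
      ∑ ν ∈ Yn n, dd ν * ∑ κ ∈ dn ν, ∑ ν' ∈ up κ, (val g ν' - val g κ) * dd ν' := by
  rw [← Finset.sum_add_distrib]
  apply Finset.sum_congr rfl; intro ν hν
  have h := commutation g dd ν
  have h1 : ∑ μ ∈ up ν, dd ν * dd μ * box g ν μ = dd ν * 
      ∑ μ ∈ up ν, ∑ ν' ∈ dn μ, (val g μ - val g ν) * dd ν' := by
    rw [Finset.mul_sum]
    apply Finset.sum_congr rfl; intro μ hμ
    rw [← Finset.mul_sum, ← dd_branch (mem_up.1 hμ).2, box]; ring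
  rw [h1, h]; ring

lemma JE_box_zero (g : ℕ × ℕ → ℝ) : JE 0 (box g) = EE 0 (MM g) := by
  rw [JE, J_expand, EE]
  have : ∑ ν ∈ Yn 0, dd ν * ∑ κ ∈ dn ν, ∑ ν' ∈ up κ, (val g ν' - val g κ) * dd ν' = 0 := by
    apply Finset.sum_eq_zero; intro ν hν
    rw [dn_zero (mem_Yn.1 hν)]; simp
  rw [this]; simp

lemma JE_box_succ (n : ℕ) (g : ℕ × ℕ → ℝ) :
    ((n : ℝ) + 2) * JE (n + 1) (box g) = (n + 1) * JE n (box g) + EE (n + 1) (MM g) := by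
  have key : ∑ ν ∈ Yn (n + 1), dd ν * ∑ κ ∈ dn ν, ∑ ν' ∈ up κ, (val g ν' - val g κ) * dd ν'
      = (n + 1) * ∑ ν ∈ Yn n, ∑ μ ∈ up ν, dd ν * dd μ * box g ν μ := by
    simp only [Finset.mul_sum (s := dn _)]
    rw [← sum_up_dn n (fun κ ν => dd ν * ∑ ν' ∈ up κ, (val g ν' - val g κ) * dd ν'),
      Finset.mul_sum]
    apply Finset.sum_congr rfl; intro κ hκ
    rw [← Finset.sum_mul, sum_up_dd n κ (mem_Yn.1 hκ), mul_assoc, Finset.mul_sum (s := up κ)]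
    congr 1
    apply Finset.sum_congr rfl; intro ν' _
    rw [box]; ring
  rw [JE, J_expand, key, JE, EE, Nat.factorial_succ (n + 1)]
  have := fact_ne (n + 1)
  push_cast
  have h : (n : ℝ) + 1 + 1 ≠ 0 := by positivity
  field_simp
  ring

/-! Generating function -/

lemma gen_fun (z : ℝ) (hz : 0 < z) (s : ℝ) (hs : s = z + z⁻¹ - 2) (n : ℕ) :
    ∀ N, n < N →
    JE n (box (fun c => z ^ (content c))) =
      ∑ k ∈ Finset.range N, (n.choose k : ℝ) * s ^ k / (k + 1).factorial ∧
    EE n (val (fun c => z ^ (content c))) =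
      ∑ k ∈ Finset.range N, (n.choose (k + 1) : ℝ) * s ^ k / (k + 1).factorial := by
  have hMM : ∀ μ, MM (fun c => z ^ (content c)) μ =
      1 + s * val (fun c => z ^ (content c)) μ := by
    intro μ
    rw [MM_content (fun x => z ^ x) μ]
    simp only [zpow_zero, val, Finset.mul_sum]
    congr 1
    apply Finset.sum_congr rfl; intro c _
    rw [zpow_add₀ hz.ne', zpow_sub₀ hz.ne', hs, zpow_one]; field_simp
  have hEM : ∀ n, EE n (MM (fun c => z ^ (content c))) =
      1 + s * EE n (val (fun c => z ^ (content c))) := by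
    intro n
    have : (MM (fun c => z ^ (content c))) = fun μ => 1 + s * val (fun c => z ^ (content c)) μ :=
      funext hMM
    rw [this, EE_add, EE_one, EE_smul]
  induction n with
  | zero =>
    intro N hN
    have e0 : EE 0 (val (fun c => z ^ (content c))) = 0 := by
      simp [EE, Yn_zero, val]
    constructor
    · rw [JE_box_zero, hEM, e0]
      rw [Finset.sum_eq_single 0]
      · simp
      · intro k _ hk
        rw [Nat.choose_eq_zero_of_lt (by omega)]; simp
      · intro h; simp at h; omega
    · rw [e0]; simp
  | succ n ih =>
    intro N hN
    have hE : EE (n + 1) (val (fun c => z ^ (content c))) =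
      ∑ k ∈ Finset.range N, ((n + 1).choose (k + 1) : ℝ) * s ^ k / (k + 1).factorial := by
      rw [EE_val_succ, (ih N (by omega)).1, (ih N (by omega)).2, ← Finset.sum_add_distrib]
      apply Finset.sum_congr rfl; intro k _
      rw [Nat.choose_succ_succ]; push_cast; ring
    refine ⟨?_, hE⟩
    have h := JE_box_succ n (fun c => z ^ (content c))
    rw [hEM, hE, (ih N (by omega)).1] at h
    have h2 : 1 + s * ∑ k ∈ Finset.range N, ((n + 1).choose (k + 1) : ℝ) * s ^ k / (k + 1).factorial
        = ∑ k ∈ Finset.range N, ((n + 1).choose k : ℝ) * s ^ k / k.factorial := by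
      have h3 : ∑ k ∈ Finset.range (N + 1), ((n + 1).choose k : ℝ) * s ^ k / k.factorial
        = ∑ k ∈ Finset.range N, ((n + 1).choose k : ℝ) * s ^ k / k.factorial := by
        rw [Finset.sum_range_succ, Nat.choose_eq_zero_of_lt hN]; simp
      rw [← h3, Finset.sum_range_succ', Finset.mul_sum, add_comm]
      congr 1
      · apply Finset.sum_congr rfl; intro k _; rw [pow_succ]; ring
      · simp
    rw [h2, Finset.mul_sum, ← Finset.sum_add_distrib] at h
    have hn : (n : ℝ) + 2 ≠ 0 := by positivity
    apply mul_left_cancel₀ hn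
    rw [h, Finset.mul_sum]
    apply Finset.sum_congr rfl; intro k _
    have h4 : ((n : ℝ) + 1) * n.choose k = ((n : ℝ) + 1 - k) * (n + 1).choose k := by
      by_cases hk : k ≤ n + 1
      · have := Nat.choose_mul_succ_eq n k
        have h5 : (n.choose k : ℝ) * (n + 1) = (n + 1).choose k * ((n + 1 - k : ℕ) : ℝ) := by
          exact_mod_cast this
        rw [Nat.cast_sub hk] at h5
        push_cast at h5
        linarith
      · rw [Nat.choose_eq_zero_of_lt (by omega), Nat.choose_eq_zero_of_lt (by omega)]; simp
    have hk := fact_ne k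
    rw [Nat.factorial_succ]; push_cast
    have hk1 : (k : ℝ) + 1 ≠ 0 := by positivity
    field_simp
    linear_combination s ^ k * h4

end PlGrowth

namespace PlGrowth

def rowg (r : ℕ) : ℕ × ℕ → ℝ := fun c => if c.1 = r then 1 else 0

lemma val_rowg (r : ℕ) (ν : YoungDiagram) : val (rowg r) ν = ν.rowLen r := val_row r ν

lemma box_eq {g : ℕ × ℕ → ℝ} {ν μ : YoungDiagram} (h : μ ∈ up ν) :
    ∃ j, box g ν μ = g (j, ν.rowLen j) ∧ ν.rowLen j + 1 = μ.rowLen j ∧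
      ∀ g' : ℕ × ℕ → ℝ, box g' ν μ = g' (j, ν.rowLen j) := by
  obtain ⟨j, h1, h2, h3, h4, h5⟩ := exists_box (mem_up.1 h).1 (mem_up.1 h).2
  exact ⟨j, val_box h1 h2, h4, fun g' => val_box h1 h2⟩

lemma box_row_cases {r : ℕ} {ν μ : YoungDiagram} (h : μ ∈ up ν) :
    box (rowg r) ν μ = 0 ∨ box (rowg r) ν μ = 1 := by
  obtain ⟨j, h1, -, -⟩ := box_eq (g := rowg r) h
  rw [h1, rowg]; split_ifs <;> simp

lemma box_row_nonneg {r : ℕ} {ν μ : YoungDiagram} (h : μ ∈ up ν) :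
    0 ≤ box (rowg r) ν μ := by
  rcases box_row_cases (r := r) h with h | h <;> rw [h]; norm_num

lemma box_row_sq {r : ℕ} {ν μ : YoungDiagram} (h : μ ∈ up ν) :
    box (rowg r) ν μ ^ 2 = box (rowg r) ν μ := by
  rcases box_row_cases (r := r) h with h | h <;> rw [h] <;> norm_num

lemma sum_up_box_le (r : ℕ) (ν : YoungDiagram) : ∑ μ ∈ up ν, box (rowg r) ν μ ≤ 1 := by
  have := sum_up_rows (rowg r) ν
  simp only [box]
  rw [this]
  simp only [rowg]
  rw [Finset.sum_ite_eq']
  split_ifs <;> norm_num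

lemma sum_dn_box_le (r : ℕ) (μ : YoungDiagram) : ∑ ν ∈ dn μ, box (rowg r) ν μ ≤ 1 := by
  have := sum_dn_rows (rowg r) μ
  simp only [box]
  rw [this]
  simp only [rowg]
  rw [Finset.sum_ite_eq']
  split_ifs <;> norm_num

noncomputable def SR (r : ℕ) (μ : YoungDiagram) : ℝ := ∑ ν ∈ dn μ, dd ν * box (rowg r) ν μ

lemma SR_nonneg (r : ℕ) (μ : YoungDiagram) : 0 ≤ SR r μ :=
  Finset.sum_nonneg fun ν hν => mul_nonneg (dd_nonneg _) (box_row_nonneg (mem_up.2 (mem_dn.1 hν)))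

lemma sum_SR_sq (r n : ℕ) : ∑ μ ∈ Yn (n + 1), SR r μ ^ 2 ≤ n.factorial := by
  have h1 : ∀ μ ∈ Yn (n + 1), SR r μ ^ 2 ≤ ∑ ν ∈ dn μ, dd ν ^ 2 * box (rowg r) ν μ := by
    intro μ hμ
    have e : SR r μ = ∑ ν ∈ dn μ, (dd ν * box (rowg r) ν μ) * box (rowg r) ν μ := by
      apply Finset.sum_congr rfl; intro ν hν
      have := box_row_sq (r := r) (mem_up.2 (mem_dn.1 hν))
      rw [mul_assoc, ← sq, this]
    rw [e]
    refine (Finset.sum_mul_sq_le_sq_mul_sq _ _ _).trans ?_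
    have e2 : ∑ ν ∈ dn μ, (box (rowg r) ν μ) ^ 2 ≤ 1 := by
      rw [Finset.sum_congr rfl fun ν hν => box_row_sq (r := r) (mem_up.2 (mem_dn.1 hν))]
      exact sum_dn_box_le r μ
    have e3 : ∑ ν ∈ dn μ, (dd ν * box (rowg r) ν μ) ^ 2 = ∑ ν ∈ dn μ, dd ν ^ 2 * box (rowg r) ν μ := by
      apply Finset.sum_congr rfl; intro ν hν
      rw [mul_pow, box_row_sq (r := r) (mem_up.2 (mem_dn.1 hν))]
    rw [← e3]
    exact mul_le_of_le_one_right (Finset.sum_nonneg fun _ _ => sq_nonneg _) e2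
  refine (Finset.sum_le_sum h1).trans ?_
  rw [← sum_up_dn n (fun ν μ => dd ν ^ 2 * box (rowg r) ν μ), ← sum_dd_sq n]
  apply Finset.sum_le_sum; intro ν _
  rw [← Finset.mul_sum]
  exact mul_le_of_le_one_right (sq_nonneg _) (sum_up_box_le r ν)

noncomputable def pp (r n : ℕ) : ℝ := JE n (box (rowg r))

lemma pp_eq (r n : ℕ) : pp r n = (∑ μ ∈ Yn (n + 1), dd μ * SR r μ) / (n + 1).factorial := by
  rw [pp, JE, sum_up_dn n (fun ν μ => dd ν * dd μ * box (rowg r) ν μ)]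
  congr 1
  apply Finset.sum_congr rfl; intro μ _
  rw [SR, Finset.mul_sum]
  apply Finset.sum_congr rfl; intro ν _; ring

lemma pp_nonneg (r n : ℕ) : 0 ≤ pp r n := by
  rw [pp_eq]
  apply div_nonneg _ (fact_pos' _).le
  exact Finset.sum_nonneg fun μ _ => mul_nonneg (dd_nonneg _) (SR_nonneg _ _)

lemma pp_sq_le (r n : ℕ) : pp r n ^ 2 ≤ 1 / (n + 1) := by
  rw [pp_eq, div_pow]
  have h := Finset.sum_mul_sq_le_sq_mul_sq (Yn (n + 1)) dd (SR r)
  rw [sum_dd_sq] at h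
  have h2 := mul_le_mul_of_nonneg_left (sum_SR_sq r n) (fact_pos' (n + 1)).le
  rw [div_le_div_iff₀ (by have := fact_pos' (n + 1); positivity) (by positivity)]
  have h3 : ((n + 1).factorial : ℝ) = (n + 1) * n.factorial := by
    rw [Nat.factorial_succ]; push_cast; ring
  calc _ ≤ ((n + 1).factorial : ℝ) * n.factorial * (n + 1) :=
        mul_le_mul_of_nonneg_right (h.trans h2) (by positivity)
    _ = _ := by rw [h3]; ring

/-- final L1 estimate -/
lemma tv_bound (r n : ℕ) (hp : 0 < pp r n) :
    ∑ μ ∈ Yn (n + 1), |dd μ ^ 2 / (n + 1).factorial -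
      (dd μ * SR r μ / (n + 1).factorial) / pp r n| ≤ √(1 / ((n + 1) * pp r n ^ 2) - 1) := by
  set p := pp r n with hpdef
  have hN := fact_pos' (n + 1)
  set N : ℝ := ((n + 1).factorial : ℝ) with hNdef
  apply Real.le_sqrt_of_sq_le
  have e : ∀ μ ∈ Yn (n + 1), |dd μ ^ 2 / N - (dd μ * SR r μ / N) / p| =
      dd μ * (|dd μ - SR r μ / p| / N) := by
    intro μ _
    have : dd μ ^ 2 / N - (dd μ * SR r μ / N) / p = dd μ * ((dd μ - SR r μ / p) / N) := by
      field_simp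
    rw [this, abs_mul, abs_of_nonneg (dd_nonneg μ), abs_div, abs_of_pos hN]
  rw [Finset.sum_congr rfl e]
  refine (Finset.sum_mul_sq_le_sq_mul_sq _ _ _).trans ?_
  rw [sum_dd_sq, ← hNdef]
  have e2 : ∑ μ ∈ Yn (n + 1), (|dd μ - SR r μ / p| / N) ^ 2 =
      (∑ μ ∈ Yn (n + 1), dd μ ^ 2 - 2 / p * ∑ μ ∈ Yn (n + 1), dd μ * SR r μ +
        1 / p ^ 2 * ∑ μ ∈ Yn (n + 1), SR r μ ^ 2) / N ^ 2 := by
    rw [Finset.mul_sum, Finset.mul_sum, ← Finset.sum_sub_distrib, ← Finset.sum_add_distrib,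
      Finset.sum_div]
    apply Finset.sum_congr rfl; intro μ _
    rw [div_pow, sq_abs]
    field_simp
    ring
  have e3 : ∑ μ ∈ Yn (n + 1), dd μ * SR r μ = p * N := by
    have := pp_eq r n
    rw [← hpdef, ← hNdef] at this
    rw [this]; field_simp
  rw [e2, sum_dd_sq, ← hNdef, e3]
  have h4 := sum_SR_sq r n
  have h3 : N = (n + 1) * n.factorial := by
    rw [hNdef, Nat.factorial_succ]; push_cast; ring
  have h5 : (n.factorial : ℝ) = N / (n + 1) := by rw [h3]; field_simp
  rw [h5] at h4
  have h6 : 1 / p ^ 2 * ∑ μ ∈ Yn (n + 1), SR r μ ^ 2 ≤ 1 / p ^ 2 * (N / (n + 1)) :=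
    mul_le_mul_of_nonneg_left h4 (by positivity)
  have h7 : N * ((N - 2 / p * (p * N) + 1 / p ^ 2 * (N / (n + 1))) / N ^ 2) =
      1 / ((n + 1) * p ^ 2) - 1 := by
    field_simp
    ring
  rw [← h7]
  gcongr

/-! Poincare inequality -/

lemma norm_U (n : ℕ) (φ : YoungDiagram → ℝ) :
    ∑ μ ∈ Yn (n + 1), (∑ ν ∈ dn μ, φ ν) ^ 2 =
      ∑ ν ∈ Yn n, φ ν ^ 2 + ∑ ν ∈ Yn n, φ ν * ∑ κ ∈ dn ν, ∑ ν' ∈ up κ, φ ν' := by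
  have h1 : ∑ μ ∈ Yn (n + 1), (∑ ν ∈ dn μ, φ ν) ^ 2 =
      ∑ μ ∈ Yn (n + 1), ∑ ν ∈ dn μ, φ ν * ∑ ν' ∈ dn μ, φ ν' := by
    apply Finset.sum_congr rfl; intro μ _
    rw [← Finset.sum_mul, sq]
  rw [h1, ← sum_up_dn n (fun ν μ => φ ν * ∑ ν' ∈ dn μ, φ ν'), ← Finset.sum_add_distrib]
  apply Finset.sum_congr rfl; intro ν _
  rw [← Finset.mul_sum, comm_one]; ring

lemma poincare_step (n : ℕ)
    (hP : ∀ φ : YoungDiagram → ℝ, ∑ ν ∈ Yn n, dd ν * φ ν = 0 →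
      ∑ μ ∈ Yn (n + 1), (∑ ν ∈ dn μ, φ ν) ^ 2 ≤ n * ∑ ν ∈ Yn n, φ ν ^ 2)
    (φ : YoungDiagram → ℝ) (h0 : ∑ ν ∈ Yn (n + 1), dd ν * φ ν = 0) :
    ∑ κ ∈ Yn n, (∑ ν ∈ up κ, φ ν) ^ 2 ≤ n * ∑ ν ∈ Yn (n + 1), φ ν ^ 2 := by
  set g : YoungDiagram → ℝ := fun κ => ∑ ν ∈ up κ, φ ν with hg
  have hg0 : ∑ κ ∈ Yn n, dd κ * g κ = 0 := by
    simp only [hg, Finset.mul_sum]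
    rw [sum_up_dn n (fun κ ν => dd κ * φ ν), ← h0]
    apply Finset.sum_congr rfl; intro μ hμ
    rw [← Finset.sum_mul, ← dd_branch (mem_Yn.1 hμ)]
  have h1 := hP g hg0
  have h2 : ∑ κ ∈ Yn n, g κ ^ 2 = ∑ ν ∈ Yn (n + 1), φ ν * ∑ κ ∈ dn ν, g κ := by
    simp only [Finset.mul_sum (s := dn _)]
    rw [← sum_up_dn n (fun κ ν => φ ν * g κ)]
    apply Finset.sum_congr rfl; intro κ _
    rw [← Finset.sum_mul, sq]
  have h3 := Finset.sum_mul_sq_le_sq_mul_sq (Yn (n + 1)) φ (fun ν => ∑ κ ∈ dn ν, g κ)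
  rw [← h2] at h3
  set Q := ∑ κ ∈ Yn n, g κ ^ 2 with hQ
  set Φ := ∑ ν ∈ Yn (n + 1), φ ν ^ 2 with hΦ
  have hQ0 : 0 ≤ Q := Finset.sum_nonneg fun _ _ => sq_nonneg _
  have hΦ0 : 0 ≤ Φ := Finset.sum_nonneg fun _ _ => sq_nonneg _
  have h4 : Q * Q ≤ (n * Φ) * Q := by
    have := mul_le_mul_of_nonneg_left h1 hΦ0
    nlinarith
  rcases hQ0.eq_or_lt with h | h
  · rw [← h]; positivity
  · exact le_of_mul_le_mul_right h4 h

lemma poincare_U (n : ℕ) : ∀ φ : YoungDiagram → ℝ, ∑ ν ∈ Yn n, dd ν * φ ν = 0 →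
      ∑ μ ∈ Yn (n + 1), (∑ ν ∈ dn μ, φ ν) ^ 2 ≤ n * ∑ ν ∈ Yn n, φ ν ^ 2 := by
  induction n with
  | zero =>
    intro φ h
    rw [Yn_zero] at h
    simp [dd_bot] at h
    rw [norm_U, Yn_zero]
    simp [h]
  | succ n ih =>
    intro φ h
    have h1 := poincare_step n ih φ h
    rw [norm_U]
    have h2 : ∑ ν ∈ Yn (n + 1), φ ν * ∑ κ ∈ dn ν, ∑ ν' ∈ up κ, φ ν' =
        ∑ κ ∈ Yn n, (∑ ν ∈ up κ, φ ν) ^ 2 := by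
      simp only [Finset.mul_sum (s := dn _)]
      rw [← sum_up_dn n (fun κ ν => φ ν * ∑ ν' ∈ up κ, φ ν')]
      apply Finset.sum_congr rfl; intro κ _
      rw [← Finset.sum_mul, sq]
    rw [h2]; push_cast; linarith

lemma poincare_D (n : ℕ) (φ : YoungDiagram → ℝ) (h0 : ∑ ν ∈ Yn (n + 1), dd ν * φ ν = 0) :
    ∑ κ ∈ Yn n, (∑ ν ∈ up κ, φ ν) ^ 2 ≤ n * ∑ ν ∈ Yn (n + 1), φ ν ^ 2 :=
  poincare_step n (poincare_U n) φ h0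

lemma variance_le (n : ℕ) (f : YoungDiagram → ℝ) :
    EE (n + 1) (fun μ => (f μ - EE (n + 1) f) ^ 2) ≤
      (n + 1) * JE n (fun ν μ => (f μ - f ν) ^ 2) := by
  set m := EE (n + 1) f with hm
  have hN := fact_pos' (n + 1)
  set φ : YoungDiagram → ℝ := fun μ => dd μ * (f μ - m) with hφ
  have h0 : ∑ ν ∈ Yn (n + 1), dd ν * φ ν = 0 := by
    have : ∑ ν ∈ Yn (n + 1), dd ν * φ ν = ∑ ν ∈ Yn (n + 1), dd ν ^ 2 * f ν -
        (∑ ν ∈ Yn (n + 1), dd ν ^ 2) * m := by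
      rw [Finset.sum_mul, ← Finset.sum_sub_distrib]
      apply Finset.sum_congr rfl; intro ν _; simp only [hφ]; ring
    rw [this, sum_dd_sq, hm, EE]; field_simp; ring
  have hP := poincare_D n φ h0
  have hA := sum_pairs_right n (fun μ => (f μ - m) ^ 2)
  have hB := sum_pairs_left n (fun ν => (f ν - m) ^ 2)
  have hC : ∑ ν ∈ Yn n, ∑ μ ∈ up ν, dd ν * dd μ * ((f μ - m) * (f ν - m)) =
      ∑ ν ∈ Yn n, (dd ν * (f ν - m)) * ∑ μ ∈ up ν, φ μ := by
    apply Finset.sum_congr rfl; intro ν _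
    rw [Finset.mul_sum]
    apply Finset.sum_congr rfl; intro μ _; simp only [hφ]; ring
  have hD : ∑ ν ∈ Yn n, ∑ μ ∈ up ν, dd ν * dd μ * (f μ - f ν) ^ 2 =
      ∑ ν ∈ Yn n, ∑ μ ∈ up ν, dd ν * dd μ * (f μ - m) ^ 2
      - 2 * ∑ ν ∈ Yn n, ∑ μ ∈ up ν, dd ν * dd μ * ((f μ - m) * (f ν - m))
      + ∑ ν ∈ Yn n, ∑ μ ∈ up ν, dd ν * dd μ * (f ν - m) ^ 2 := by
    rw [Finset.mul_sum, ← Finset.sum_sub_distrib, ← Finset.sum_add_distrib]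
    apply Finset.sum_congr rfl; intro ν _
    rw [Finset.mul_sum, ← Finset.sum_sub_distrib, ← Finset.sum_add_distrib]
    apply Finset.sum_congr rfl; intro μ _; ring
  have hE : 2 * ∑ ν ∈ Yn n, (dd ν * (f ν - m)) * ∑ μ ∈ up ν, φ μ ≤
      (n + 1) * ∑ ν ∈ Yn n, dd ν ^ 2 * (f ν - m) ^ 2 +
        (1 / (n + 1)) * ∑ κ ∈ Yn n, (∑ ν ∈ up κ, φ ν) ^ 2 := by
    rw [Finset.mul_sum, Finset.mul_sum, Finset.mul_sum, ← Finset.sum_add_distrib]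
    apply Finset.sum_le_sum; intro ν _
    have hn : (0 : ℝ) < n + 1 := by positivity
    have : 0 ≤ (1 / ((n : ℝ) + 1)) * ((n + 1) * (dd ν * (f ν - m)) - ∑ μ ∈ up ν, φ μ) ^ 2 := by
      positivity
    have e : (1 / ((n : ℝ) + 1)) * ((n + 1) * (dd ν * (f ν - m)) - ∑ μ ∈ up ν, φ μ) ^ 2 =
       (n + 1) * (dd ν ^ 2 * (f ν - m) ^ 2) - 2 * ((dd ν * (f ν - m)) * ∑ μ ∈ up ν, φ μ) +
       (1 / (n + 1)) * (∑ μ ∈ up ν, φ μ) ^ 2 := by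
      field_simp; ring
    linarith
  have hΦ : ∑ ν ∈ Yn (n + 1), φ ν ^ 2 = ∑ ν ∈ Yn (n + 1), dd ν ^ 2 * (f ν - m) ^ 2 := by
    apply Finset.sum_congr rfl; intro ν _; simp only [hφ]; ring
  rw [hΦ] at hP
  rw [hA, hB, hC] at hD
  rw [EE, JE, ← mul_div_assoc]
  apply div_le_div_of_nonneg_right _ hN.le
  have hn : (0 : ℝ) < n + 1 := by positivity
  have h9 : (1 / ((n : ℝ) + 1)) * ∑ κ ∈ Yn n, (∑ ν ∈ up κ, φ ν) ^ 2 ≤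
      (1 / ((n : ℝ) + 1)) * (n * ∑ ν ∈ Yn (n + 1), dd ν ^ 2 * (f ν - m) ^ 2) :=
    mul_le_mul_of_nonneg_left hP (by positivity)
  set Φ := ∑ ν ∈ Yn (n + 1), dd ν ^ 2 * (f ν - m) ^ 2
  have h10 : Φ - (1 / ((n : ℝ) + 1)) * (n * Φ) ≤
      ∑ ν ∈ Yn n, ∑ μ ∈ up ν, dd ν * dd μ * (f μ - f ν) ^ 2 := by
    rw [hD]; linarith
  have h11 := mul_le_mul_of_nonneg_left h10 hn.le
  have h12 : ((n : ℝ) + 1) * (Φ - (1 / ((n : ℝ) + 1)) * (n * Φ)) = Φ := by field_simp; ring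
  linarith

lemma var_row (r n : ℕ) :
    EE (n + 1) (fun μ => ((μ.rowLen r : ℝ) - EE (n + 1) (val (rowg r))) ^ 2) ≤
      (n + 1) * pp r n := by
  have h := variance_le n (val (rowg r))
  have e : JE n (fun ν μ => (val (rowg r) μ - val (rowg r) ν) ^ 2) = pp r n := by
    apply JE_congr
    intro ν μ _ hμ
    exact box_row_sq hμ
  rw [e] at h
  simpa only [val_rowg] using h

lemma tail_le (r n : ℕ) (L : ℝ) :
    JE n (box (fun c => if L ≤ (content c : ℝ) then 1 else 0)) ≤
      ∑ i ∈ Finset.range r, pp i n + EE (n + 1) (fun μ => if L ≤ (μ.rowLen r : ℝ) then 1 else 0) := by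
  simp only [pp]
  rw [← JE_sum, ← JE_right, ← JE_add]
  apply JE_mono
  intro ν μ _ hμ
  obtain ⟨j, -, h2, h3⟩ := box_eq (g := rowg r) hμ
  simp only [h3, rowg]
  rw [Finset.sum_ite_eq]
  simp only [Finset.mem_range]
  by_cases hj : j < r
  · simp only [hj, if_true]
    split_ifs <;> norm_num
  · simp only [hj, if_false, zero_add]
    by_cases hL : L ≤ (content (j, ν.rowLen j) : ℝ)
    · have h4 := μ.rowLen_anti r j (by omega)
      have h5 : L ≤ (μ.rowLen r : ℝ) := by
        refine hL.trans ?_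
        have : content (j, ν.rowLen j) ≤ (μ.rowLen r : ℤ) := by
          simp only [content]; omega
        exact_mod_cast this
      simp [hL, h5]
    · simp only [hL, if_false]
      split_ifs <;> norm_num

end PlGrowth

namespace PlGrowth

lemma pp_le (r n : ℕ) : pp r n ≤ 1 / √((n : ℝ) + 1) := by
  have h := pp_sq_le r n
  have h2 : (1 / √((n : ℝ) + 1)) ^ 2 = 1 / (n + 1) := by
    rw [div_pow, Real.sq_sqrt (by positivity)]; norm_num
  rw [← h2] at h
  exact (sq_le_sq₀ (pp_nonneg r n) (by positivity)).1 h

lemma exists_m (ε : ℝ) (hε : 0 < ε) : ∃ m : ℕ, 1 ≤ m ∧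
    3 * Real.exp ((2 - ε) * m) ≤ (m : ℝ) ^ (2 * m) / (m.factorial * (m + 1).factorial) := by
  have h1 : ∀ᶠ m : ℕ in atTop, Stirling.stirlingSeq m < 2 := by
    apply Stirling.tendsto_stirlingSeq_sqrt_pi.eventually_lt_const
    rw [Real.sqrt_lt' (by norm_num)]
    have := Real.pi_lt_four
    linarith
  have h2 : ∀ᶠ m : ℕ in atTop, (m : ℝ) ^ 2 / Real.exp (ε * m) < 1 / 48 := by
    have ht : Tendsto (fun m : ℕ => ε * (m : ℝ)) atTop atTop :=
      tendsto_natCast_atTop_atTop.const_mul_atTop hε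
    have h := ((Real.tendsto_pow_mul_exp_neg_atTop_nhds_zero 2).comp ht).eventually_lt_const
      (by positivity : (0:ℝ) < ε ^ 2 / 48)
    filter_upwards [h] with m hm
    simp only [Function.comp] at hm
    rw [Real.exp_neg, mul_pow] at hm
    have e : ε ^ 2 * ((m : ℝ) ^ 2 / Real.exp (ε * m)) < ε ^ 2 * (1 / 48) := by
      calc _ = ε ^ 2 * (m : ℝ) ^ 2 * (Real.exp (ε * m))⁻¹ := by ring
        _ < _ := by linarith
    exact lt_of_mul_lt_mul_left e (by positivity)
  obtain ⟨m, hm1, hm2, hm3⟩ := (h1.and (h2.and (eventually_ge_atTop 1))).exists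
  refine ⟨m, hm3, ?_⟩
  have hm : (1 : ℝ) ≤ m := by exact_mod_cast hm3
  have hm0 : (0 : ℝ) < m := by linarith
  rw [Stirling.stirlingSeq] at hm1
  have hpos : 0 < √(2 * (m : ℝ)) * ((m : ℝ) / Real.exp 1) ^ m := by positivity
  rw [div_lt_iff₀ hpos] at hm1
  have hf : (m.factorial : ℝ) ^ 2 ≤ 8 * m * ((m : ℝ) / Real.exp 1) ^ (2 * m) := by
    have := pow_le_pow_left₀ (fact_pos' m).le hm1.le 2
    have e : (2 * (√(2 * (m : ℝ)) * ((m : ℝ) / Real.exp 1) ^ m)) ^ 2 =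
        8 * m * ((m : ℝ) / Real.exp 1) ^ (2 * m) := by
      rw [mul_pow, mul_pow, Real.sq_sqrt (by positivity), ← pow_mul, mul_comm m 2]; ring
    rwa [e] at this
  have e3 : ((m : ℝ) / Real.exp 1) ^ (2 * m) = (m : ℝ) ^ (2 * m) / Real.exp (2 * m) := by
    rw [div_pow, ← Real.exp_nat_mul]; push_cast; rw [mul_one]
  rw [e3] at hf
  have hfac : (m.factorial : ℝ) * (m + 1).factorial ≤ 16 * m ^ 2 * ((m : ℝ) ^ (2 * m) / Real.exp (2 * m)) := by
    rw [Nat.factorial_succ]; push_cast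
    calc (m.factorial : ℝ) * ((m + 1) * m.factorial) = (m + 1) * (m.factorial : ℝ) ^ 2 := by ring
      _ ≤ (2 * m) * (8 * m * ((m : ℝ) ^ (2 * m) / Real.exp (2 * m))) := by
          apply mul_le_mul _ hf (by positivity) (by positivity); linarith
      _ = _ := by ring
  rw [le_div_iff₀ (mul_pos (fact_pos' m) (fact_pos' _))]
  rw [div_lt_iff₀ (Real.exp_pos _)] at hm2
  have e4 : Real.exp ((2 - ε) * m) = Real.exp (2 * m) / Real.exp (ε * m) := by
    rw [← Real.exp_sub]; congr 1; ring
  calc 3 * Real.exp ((2 - ε) * m) * ((m.factorial : ℝ) * (m + 1).factorial)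
      ≤ 3 * Real.exp ((2 - ε) * m) * (16 * m ^ 2 * ((m : ℝ) ^ (2 * m) / Real.exp (2 * m))) :=
        mul_le_mul_of_nonneg_left hfac (by positivity)
    _ = 48 * (m : ℝ) ^ 2 / Real.exp (ε * m) * (m : ℝ) ^ (2 * m) := by
        rw [e4]; field_simp; ring
    _ ≤ 1 * (m : ℝ) ^ (2 * m) := by
        apply mul_le_mul_of_nonneg_right _ (by positivity)
        rw [div_le_one (Real.exp_pos _)]; linarith
    _ = _ := one_mul _

lemma s_lower (x : ℝ) : x ^ 2 ≤ Real.exp x + (Real.exp x)⁻¹ - 2 := by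
  rw [← Real.exp_neg]
  have h := Real.cosh_eq x
  have h2 : Real.cosh x = 1 + 2 * Real.sinh (x / 2) ^ 2 := by
    have := Real.cosh_two_mul (x / 2)
    rw [Real.cosh_sq] at this
    rw [show 2 * (x / 2) = x by ring] at this
    linarith
  have h3 : (x / 2) ^ 2 ≤ Real.sinh (x / 2) ^ 2 := by
    rw [sq_le_sq, Real.abs_sinh]
    exact Real.self_le_sinh_iff.2 (abs_nonneg _)
  nlinarith

lemma s_upper (x : ℝ) (hx : x ^ 2 ≤ 2) : Real.exp x + (Real.exp x)⁻¹ - 2 ≤ 2 * x ^ 2 := by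
  rw [← Real.exp_neg]
  have h := Real.cosh_eq x
  have h2 := Real.cosh_le_exp_half_sq x
  have h3 : |Real.exp (x ^ 2 / 2) - 1| ≤ 2 * |x ^ 2 / 2| := by
    apply Real.abs_exp_sub_one_le
    rw [abs_of_nonneg (by positivity)]; linarith
  rw [abs_of_nonneg (by positivity : 0 ≤ x ^ 2 / 2)] at h3
  have := (abs_le.1 h3).2
  linarith

lemma mgf_upper (n : ℕ) (t : ℝ) (ht : t ^ 2 ≤ 2 * (n + 1)) :
    JE n (box (fun c => Real.exp (t / √((n : ℝ) + 1)) ^ (content c))) ≤ Real.exp (2 * t ^ 2) := by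
  set x := t / √((n : ℝ) + 1) with hx
  have hx2 : x ^ 2 = t ^ 2 / (n + 1) := by rw [hx, div_pow, Real.sq_sqrt (by positivity)]
  have hn : (0 : ℝ) < n + 1 := by positivity
  set s := Real.exp x + (Real.exp x)⁻¹ - 2 with hs
  have hs0 : 0 ≤ s := (sq_nonneg x).trans (s_lower x)
  have hs1 : s ≤ 2 * x ^ 2 := s_upper x (by rw [hx2, div_le_iff₀ hn]; exact ht)
  rw [(gen_fun (Real.exp x) (Real.exp_pos x) s hs n (n + 1) (by omega)).1]
  have h1 : ∑ k ∈ Finset.range (n + 1), (n.choose k : ℝ) * s ^ k / (k + 1).factorial ≤ (s + 1) ^ n := by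
    rw [add_pow]
    apply Finset.sum_le_sum; intro k _
    rw [one_pow, mul_one]
    have : (1 : ℝ) ≤ (k + 1).factorial := by exact_mod_cast Nat.succ_le_of_lt (Nat.factorial_pos _)
    rw [mul_comm (s ^ k)]
    exact div_le_self (by positivity) this
  refine h1.trans ?_
  calc (s + 1) ^ n ≤ Real.exp s ^ n := pow_le_pow_left₀ (by linarith) (Real.add_one_le_exp s) n
    _ = Real.exp (n * s) := by rw [Real.exp_nat_mul]
    _ ≤ _ := by
      apply Real.exp_le_exp.2
      have h3 : (n : ℝ) * s ≤ n * (2 * x ^ 2) := mul_le_mul_of_nonneg_left hs1 (by positivity)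
      have h4 : (n : ℝ) * (2 * x ^ 2) ≤ (n + 1) * (2 * x ^ 2) := by
        apply mul_le_mul_of_nonneg_right _ (by positivity); linarith
      have h5 : ((n : ℝ) + 1) * (2 * x ^ 2) = 2 * t ^ 2 := by rw [hx2]; field_simp
      linarith

lemma mgf_lower (n m : ℕ) (hmn : m ≤ n) :
    (1 - m / ((n : ℝ) + 1)) ^ m * ((m : ℝ) ^ (2 * m) / (m.factorial * (m + 1).factorial)) ≤
    JE n (box (fun c => Real.exp (m / √((n : ℝ) + 1)) ^ (content c))) := by
  set x := (m : ℝ) / √((n : ℝ) + 1) with hx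
  have hx2 : x ^ 2 = (m : ℝ) ^ 2 / (n + 1) := by rw [hx, div_pow, Real.sq_sqrt (by positivity)]
  have hn : (0 : ℝ) < n + 1 := by positivity
  set s := Real.exp x + (Real.exp x)⁻¹ - 2 with hs
  have hs0 : x ^ 2 ≤ s := s_lower x
  have hs00 : 0 ≤ s := (sq_nonneg x).trans hs0
  rw [(gen_fun (Real.exp x) (Real.exp_pos x) s hs n (n + 1) (by omega)).1]
  have h1 : (n.choose m : ℝ) * s ^ m / (m + 1).factorial ≤
      ∑ k ∈ Finset.range (n + 1), (n.choose k : ℝ) * s ^ k / (k + 1).factorial := by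
    apply Finset.single_le_sum (f := fun k => (n.choose k : ℝ) * s ^ k / (k + 1).factorial)
    · intro k _; positivity
    · simp; omega
  refine le_trans ?_ h1
  have h2 : (((n + 1 - m : ℕ) : ℝ)) ^ m ≤ m.factorial * n.choose m := by
    have := Nat.pow_sub_le_descFactorial n m
    rw [Nat.descFactorial_eq_factorial_mul_choose] at this
    exact_mod_cast this
  rw [Nat.cast_sub (by omega)] at h2
  push_cast at h2
  have h3 : (x ^ 2) ^ m ≤ s ^ m := pow_le_pow_left₀ (sq_nonneg _) hs0 m
  have h4 : ((1 : ℝ) - m / ((n : ℝ) + 1)) ^ m = ((n : ℝ) + 1 - m) ^ m / ((n : ℝ) + 1) ^ m := by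
    rw [← div_pow]; congr 1; field_simp
  have h5 : (n : ℝ) + 1 - m ≥ 0 := by
    have : (m : ℝ) ≤ n := by exact_mod_cast hmn
    linarith
  have f1 := fact_pos' m
  have f2 := fact_pos' (m + 1)
  calc (1 - m / ((n : ℝ) + 1)) ^ m * ((m : ℝ) ^ (2 * m) / (m.factorial * (m + 1).factorial))
      = ((n : ℝ) + 1 - m) ^ m / m.factorial * (x ^ 2) ^ m / (m + 1).factorial := by
        rw [h4, hx2, div_pow, ← pow_mul]; field_simp
    _ ≤ n.choose m * s ^ m / (m + 1).factorial := by
        apply div_le_div_of_nonneg_right _ f2.le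
        apply mul_le_mul _ h3 (by positivity) (by positivity)
        rw [div_le_iff₀ f1]; linarith

lemma tail_lower (ε : ℝ) (hε : 0 < ε) : ∃ δ : ℝ, 0 < δ ∧ ∀ᶠ n : ℕ in atTop,
    δ ≤ JE n (box (fun c => if (2 - ε) * √((n : ℝ) + 1) ≤ (content c : ℝ) then 1 else 0)) := by
  obtain ⟨m, hm1, hm⟩ := exists_m ε hε
  set A := Real.exp ((2 - ε) * m) with hA
  set B := Real.exp (2 * (2 * (m : ℝ)) ^ 2) with hB
  have hA0 : 0 < A := Real.exp_pos _
  have hB0 : 0 < B := Real.exp_pos _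
  refine ⟨A ^ 2 / B, by positivity, ?_⟩
  have hlim : Tendsto (fun n : ℕ => (1 - (m : ℝ) / ((n : ℝ) + 1)) ^ m) atTop (nhds 1) := by
    have : Tendsto (fun n : ℕ => (m : ℝ) / ((n : ℝ) + 1)) atTop (nhds 0) := by
      have h := (tendsto_one_div_add_atTop_nhds_zero_nat (𝕜 := ℝ)).const_mul (m : ℝ)
      simp only [mul_zero] at h
      refine h.congr (fun n => by ring)
    have h2 := (this.const_sub 1).pow m
    simpa using h2
  have hev := hlim.eventually_const_lt (by norm_num : (2 / 3 : ℝ) < 1)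
  have hev2 : ∀ᶠ n : ℕ in atTop, (2 * (m : ℝ)) ^ 2 ≤ 2 * (n + 1) := by
    have := tendsto_natCast_atTop_atTop (R := ℝ) |>.eventually_ge_atTop ((2 * (m : ℝ)) ^ 2)
    filter_upwards [this] with n hn
    have : (0 : ℝ) ≤ n := by positivity
    linarith
  filter_upwards [hev, hev2, eventually_ge_atTop m] with n h1 h2 h3
  have hlow := mgf_lower n m h3
  have hup := mgf_upper n (2 * m) h2
  rw [← hB] at hup
  set x := (m : ℝ) / √((n : ℝ) + 1) with hx
  have hsq : 0 < √((n : ℝ) + 1) := Real.sqrt_pos.2 (by positivity)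
  have hlow2 : 2 * A ≤ JE n (box (fun c => Real.exp x ^ (content c))) := by
    refine le_trans ?_ hlow
    calc 2 * A = 2 / 3 * (3 * A) := by ring
      _ ≤ _ := mul_le_mul h1.le hm (by positivity) (by linarith)
  set q := JE n (box (fun c => if (2 - ε) * √((n : ℝ) + 1) ≤ (content c : ℝ) then 1 else 0)) with hq
  have hJ : JE n (box (fun c => Real.exp x ^ (content c))) ≤
      A + (A / B / 2 * JE n (box (fun c => Real.exp (2 * m / √((n : ℝ) + 1)) ^ (content c)))
        + B / A / 2 * q) := by
    have e1 : A = JE n (fun _ _ => A) := by rw [JE_right n (fun _ => A), EE_const]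
    have e2 : ∀ (c : ℝ) (F : YoungDiagram → YoungDiagram → ℝ), c * JE n F = JE n (fun ν μ => c * F ν μ) := by
      intro c F
      simp only [JE, Finset.mul_sum, ← mul_div_assoc]
      congr 1
      apply Finset.sum_congr rfl; intro ν _
      apply Finset.sum_congr rfl; intro μ _; ring
    rw [hq, e2, e2, ← JE_add]
    have e0 : ∀ G : YoungDiagram → YoungDiagram → ℝ,
        A + JE n G = JE n (fun ν μ => A + G ν μ) := by
      intro G
      rw [JE_add n (fun _ _ => A), ← e1]
    rw [e0]
    apply JE_mono
    intro ν μ _ hμ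
    obtain ⟨j, -, -, hb⟩ := box_eq (g := rowg 0) hμ
    simp only [hb]
    set c : ℤ := content (j, ν.rowLen j)
    have e3 : Real.exp (2 * m / √((n : ℝ) + 1)) ^ c = (Real.exp x ^ c) ^ 2 := by
      have : Real.exp (2 * m / √((n : ℝ) + 1)) = Real.exp x ^ 2 := by
        rw [← Real.exp_nat_mul]; congr 1; rw [hx]; push_cast; ring
      rw [this, ← zpow_natCast, ← zpow_natCast, ← zpow_mul, ← zpow_mul, mul_comm]
    rw [e3]
    set y := Real.exp x ^ c with hy
    have hy0 : 0 < y := by positivity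
    split_ifs with hc
    · have : y ≤ A / B / 2 * y ^ 2 + B / A / 2 * 1 := by
        have h : 0 ≤ A / B / 2 * (y - B / A) ^ 2 := by positivity
        have e : A / B / 2 * (y - B / A) ^ 2 = A / B / 2 * y ^ 2 + B / A / 2 - y := by
          field_simp; ring
        linarith
      linarith
    · have : y ≤ A := by
        rw [hy, ← Real.rpow_intCast, ← Real.exp_mul, mul_comm, hA]
        apply Real.exp_le_exp.2
        push Not at hc
        have hm' : (0 : ℝ) ≤ m := by positivity
        calc (c : ℝ) * x = (c / √((n : ℝ) + 1)) * m := by rw [hx]; ring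
          _ ≤ (2 - ε) * m := by
            apply mul_le_mul_of_nonneg_right _ hm'
            rw [div_le_iff₀ hsq]; exact hc.le
      have h' : 0 ≤ A / B / 2 * y ^ 2 := by positivity
      linarith
  have h6 : A / B / 2 * JE n (box (fun c => Real.exp (2 * m / √((n : ℝ) + 1)) ^ (content c))) ≤ A / 2 := by
    calc _ ≤ A / B / 2 * B := mul_le_mul_of_nonneg_left hup (by positivity)
      _ = A / 2 := by field_simp
  have h7 : A / 2 ≤ B / A / 2 * q := by linarith
  rw [div_le_iff₀ hB0]
  have h8 : B / A / 2 * q = q * B / A / 2 := by ring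
  rw [h8] at h7
  have h9 : A ≤ q * B / A := by linarith
  rw [le_div_iff₀ hA0] at h9
  linarith [sq A]

end PlGrowth

namespace PlGrowth

lemma row_mean (r n : ℕ) : EE n (val (rowg r)) = ∑ i ∈ Finset.range n, pp r i := by
  induction n with
  | zero =>
    rw [EE, Yn_zero]
    simp [val]
  | succ n ih => rw [EE_val_succ, ih, Finset.sum_range_succ, pp, add_comm]

lemma sqrt_atTop : Tendsto (fun n : ℕ => √((n : ℝ) + 1)) atTop atTop :=
  Real.tendsto_sqrt_atTop.comp
    (tendsto_atTop_add_const_right _ _ tendsto_natCast_atTop_atTop)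

lemma mean_lower (r : ℕ) (ε : ℝ) (hε : 0 < ε) : ∀ᶠ n : ℕ in atTop,
    (2 - ε) * √((n : ℝ) + 1) ≤ ∑ i ∈ Finset.range (n + 1), pp r i := by
  obtain ⟨δ, hδ, hev⟩ := tail_lower (ε / 2) (by positivity)
  have h1 := sqrt_atTop.eventually_ge_atTop (2 * r / δ)
  have h2 := sqrt_atTop.eventually_gt_atTop (1 / (δ / 2 * (ε / 2) ^ 2))
  filter_upwards [hev, h1, h2] with n hn h1 h2
  rw [← row_mean]
  by_contra hcon
  push Not at hcon
  have hS2 : √((n : ℝ) + 1) ^ 2 = n + 1 := Real.sq_sqrt (by positivity)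
  have hS : 0 < √((n : ℝ) + 1) := Real.sqrt_pos.2 (by positivity)
  have ht := tail_le r n ((2 - ε / 2) * √((n : ℝ) + 1))
  have hv := var_row r n
  have hp := pp_le r n
  have hple : ∀ i, pp i n ≤ 1 / √((n : ℝ) + 1) := fun i => pp_le i n
  set S := √((n : ℝ) + 1) with hSdef
  set e := EE (n + 1) (val (rowg r)) with he
  have hsum : ∑ i ∈ Finset.range r, pp i n ≤ δ / 2 := by
    calc ∑ i ∈ Finset.range r, pp i n ≤ ∑ i ∈ Finset.range r, 1 / S :=
          Finset.sum_le_sum fun i _ => hple i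
      _ = r / S := by simp [div_eq_mul_inv]
      _ ≤ δ / 2 := by
        rw [div_le_iff₀ hδ] at h1
        rw [div_le_iff₀ hS]; linarith
  have hind : ((ε / 2) * S) ^ 2 * EE (n + 1) (fun μ => if (2 - ε / 2) * S ≤ (μ.rowLen r : ℝ) then 1 else 0) ≤
      EE (n + 1) (fun μ => ((μ.rowLen r : ℝ) - e) ^ 2) := by
    rw [← EE_smul]
    apply EE_mono
    intro μ _
    split_ifs with h
    · rw [mul_one]
      apply pow_le_pow_left₀ (by positivity)
      nlinarith
    · rw [mul_zero]; positivity
  have h3 : δ / 2 ≤ EE (n + 1) (fun μ => if (2 - ε / 2) * S ≤ (μ.rowLen r : ℝ) then 1 else 0) := by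
    linarith
  have h4 : ((ε / 2) * S) ^ 2 * (δ / 2) ≤ S := by
    calc _ ≤ _ := mul_le_mul_of_nonneg_left h3 (by positivity)
      _ ≤ _ := hind
      _ ≤ _ := hv
      _ ≤ (n + 1) * (1 / S) := mul_le_mul_of_nonneg_left hp (by positivity)
      _ = S := by rw [← hS2]; field_simp
  rw [div_lt_iff₀ (by positivity)] at h2
  nlinarith

lemma sum_inv_sqrt (M : ℕ) : ∑ i ∈ Finset.range M, 1 / √((i : ℝ) + 1) ≤ 2 * √(M : ℝ) := by
  induction M with
  | zero => simp
  | succ M ih =>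
    rw [Finset.sum_range_succ]
    push_cast
    have ha : 0 ≤ √(M : ℝ) := Real.sqrt_nonneg _
    have hb : 0 < √((M : ℝ) + 1) := Real.sqrt_pos.2 (by positivity)
    have ha2 : √(M : ℝ) ^ 2 = M := Real.sq_sqrt (by positivity)
    have hb2 : √((M : ℝ) + 1) ^ 2 = M + 1 := Real.sq_sqrt (by positivity)
    set a := √(M : ℝ)
    set b := √((M : ℝ) + 1)
    have : 1 / b ≤ 2 * b - 2 * a := by
      rw [div_le_iff₀ hb]
      nlinarith [sq_nonneg (b - a)]
    linarith

lemma tauberian (s : ℕ → ℝ) (K : ℝ) (hK : 0 ≤ K) (hs0 : ∀ n, 0 ≤ s n)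
    (hmono : Monotone (fun n : ℕ => ((n : ℝ) + 1) * s n))
    (hle : ∀ n : ℕ, s n ≤ K / √((n : ℝ) + 1))
    (hsum : ∀ ε : ℝ, 0 < ε → ∀ᶠ n : ℕ in atTop,
      K * ((2 - ε) * √((n : ℝ) + 1)) ≤ ∑ i ∈ Finset.range (n + 1), s i)
    (η : ℝ) (hη : 0 < η) (hη1 : η < 1) :
    ∀ᶠ n : ℕ in atTop, K * (1 - 3 * η) ≤ √((n : ℝ) + 1) * s n := by
  have h2 := sqrt_atTop.eventually_ge_atTop (2 / η ^ 2)
  filter_upwards [hsum (η ^ 2) (by positivity), h2] with n h1 h2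
  have hS2 : √((n : ℝ) + 1) ^ 2 = n + 1 := Real.sq_sqrt (by positivity)
  have hS : 0 < √((n : ℝ) + 1) := Real.sqrt_pos.2 (by positivity)
  set S := √((n : ℝ) + 1) with hSdef
  have hN : (0 : ℝ) < n + 1 := by positivity
  set θ := 1 - η with hθ
  have hθ0 : 0 < θ := by linarith
  have hθ1 : θ < 1 := by linarith
  set M := ⌈θ ^ 2 * ((n : ℝ) + 1)⌉₊ with hM
  have hM1 : θ ^ 2 * ((n : ℝ) + 1) ≤ M := Nat.le_ceil _
  have hM2 : (M : ℝ) ≤ θ ^ 2 * ((n : ℝ) + 1) + 1 := (Nat.ceil_lt_add_one (by positivity)).le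
  have hMN : M ≤ n + 1 := by
    apply Nat.ceil_le.2
    push_cast
    have : θ ^ 2 ≤ 1 := by nlinarith
    nlinarith
  have hsplit := Finset.sum_range_add_sum_Ico s hMN
  have hA : ∑ i ∈ Finset.range M, s i ≤ K * (2 * (θ * S + 1)) := by
    calc ∑ i ∈ Finset.range M, s i ≤ ∑ i ∈ Finset.range M, K * (1 / √((i : ℝ) + 1)) :=
          Finset.sum_le_sum fun i _ => by rw [mul_one_div]; exact hle i
      _ = K * ∑ i ∈ Finset.range M, 1 / √((i : ℝ) + 1) := by rw [Finset.mul_sum]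
      _ ≤ K * (2 * √(M : ℝ)) := mul_le_mul_of_nonneg_left (sum_inv_sqrt M) hK
      _ ≤ _ := by
        apply mul_le_mul_of_nonneg_left _ hK
        apply mul_le_mul_of_nonneg_left _ (by norm_num)
        apply Real.sqrt_le_iff.2
        refine ⟨by positivity, ?_⟩
        have : 0 < θ * S := by positivity
        nlinarith
  have hB : ∑ i ∈ Finset.Ico M (n + 1), s i ≤ (1 - θ ^ 2) / θ ^ 2 * (S ^ 2 * s n) := by
    have hterm : ∀ i ∈ Finset.Ico M (n + 1), s i ≤ s n / θ ^ 2 := by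
      intro i hi
      rw [Finset.mem_Ico] at hi
      have h3 : ((i : ℝ) + 1) * s i ≤ ((n : ℝ) + 1) * s n := hmono (by omega : i ≤ n)
      have h4 : (M : ℝ) ≤ i := by exact_mod_cast hi.1
      rw [le_div_iff₀ (by positivity)]
      have h5 : θ ^ 2 * ((n : ℝ) + 1) * s i ≤ ((n : ℝ) + 1) * s n := by
        refine le_trans ?_ h3
        apply mul_le_mul_of_nonneg_right _ (hs0 i); linarith
      have h6 : ((n : ℝ) + 1) * (s i * θ ^ 2) ≤ ((n : ℝ) + 1) * s n := by linarith
      exact le_of_mul_le_mul_left h6 hN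
    calc _ ≤ (Finset.Ico M (n + 1)).card • (s n / θ ^ 2) := Finset.sum_le_card_nsmul _ _ _ hterm
      _ = ((n : ℝ) + 1 - M) * (s n / θ ^ 2) := by
        rw [Nat.card_Ico, nsmul_eq_mul, Nat.cast_sub hMN]; push_cast; rfl
      _ ≤ ((1 - θ ^ 2) * S ^ 2) * (s n / θ ^ 2) := by
        apply mul_le_mul_of_nonneg_right _ (div_nonneg (hs0 n) (by positivity))
        rw [hS2]; linarith
      _ = _ := by ring
  set u := S * s n with hu
  have hu0 : 0 ≤ u := mul_nonneg hS.le (hs0 n)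
  have hB' : (1 - θ ^ 2) / θ ^ 2 * (S ^ 2 * s n) = S * ((1 - θ ^ 2) / θ ^ 2 * u) := by
    rw [hu]; ring
  have h7 : S * (K * (2 - η ^ 2 - 2 * θ)) ≤ 2 * K + S * ((1 - θ ^ 2) / θ ^ 2 * u) := by
    rw [← hB']
    nlinarith
  have h8 : 2 ≤ S * η ^ 2 := by rwa [div_le_iff₀ (by positivity)] at h2
  have h9 : S * (K * (2 - 2 * η ^ 2 - 2 * θ)) ≤ S * ((1 - θ ^ 2) / θ ^ 2 * u) := by
    have := mul_le_mul_of_nonneg_left h8 hK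
    linarith
  have h10 := le_of_mul_le_mul_left h9 hS
  have h11 : K * (2 * η * (1 - η)) * θ ^ 2 ≤ (η * (2 - η)) * u := by
    have e : (1 - θ ^ 2) / θ ^ 2 * u = (1 - θ ^ 2) * u / θ ^ 2 := by ring
    rw [e, le_div_iff₀ (by positivity)] at h10
    have e1 : 2 - 2 * η ^ 2 - 2 * θ = 2 * η * (1 - η) := by rw [hθ]; ring
    have e2 : 1 - θ ^ 2 = η * (2 - η) := by rw [hθ]; ring
    rwa [e1, e2] at h10
  have h12 : (2 * η) * (K * θ ^ 3) ≤ (2 * η) * u := by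
    calc (2 * η) * (K * θ ^ 3) = K * (2 * η * (1 - η)) * θ ^ 2 := by rw [hθ]; ring
      _ ≤ _ := h11
      _ ≤ _ := by apply mul_le_mul_of_nonneg_right _ hu0; nlinarith
  have h13 := le_of_mul_le_mul_left h12 (by positivity)
  refine le_trans ?_ h13
  apply mul_le_mul_of_nonneg_left _ hK
  have : θ ^ 3 - (1 - 3 * η) = η ^ 2 * (3 - η) := by rw [hθ]; ring
  have : 0 ≤ η ^ 2 * (3 - η) := mul_nonneg (sq_nonneg _) (by linarith)
  linarith

lemma pp_sum_mono (r : ℕ) :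
    Monotone (fun n : ℕ => ((n : ℝ) + 1) * ∑ j ∈ Finset.range (r + 1), pp j n) := by
  have key : ∀ n, ∑ j ∈ Finset.range (r + 1), pp j n =
      JE n (box (fun c => if c.1 ≤ r then 1 else 0)) := by
    intro n
    simp only [pp]
    rw [← JE_sum]
    apply JE_congr
    intro ν μ _ h
    obtain ⟨j, -, -, hb⟩ := box_eq (g := rowg 0) h
    simp only [hb, rowg]
    rw [Finset.sum_ite_eq]
    simp
  apply monotone_nat_of_le_succ
  intro n
  simp only [key]
  have h := JE_box_succ n (fun c => if c.1 ≤ r then (1 : ℝ) else 0)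
  have h2 : 0 ≤ EE (n + 1) (MM (fun c => if c.1 ≤ r then (1 : ℝ) else 0)) := by
    have := EE_mono (n := n + 1) (f := fun _ => (0 : ℝ)) (fun μ _ => MM_row_nonneg r μ)
    rwa [EE_const] at this
  push_cast
  have e : (n : ℝ) + 1 + 1 = n + 2 := by ring
  rw [e]; linarith

lemma pp_lower (r : ℕ) (ε : ℝ) (hε : 0 < ε) :
    ∀ᶠ n : ℕ in atTop, 1 - ε ≤ √((n : ℝ) + 1) * pp r n := by
  obtain ⟨η, hη, hη1, hη2⟩ : ∃ η : ℝ, 0 < η ∧ η < 1 ∧ ((r : ℝ) + 1) * (3 * η) ≤ ε := by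
    refine ⟨min (1 / 2) (ε / (3 * (r + 1))), by positivity, ?_, ?_⟩
    · exact (min_le_left _ _).trans_lt (by norm_num)
    · have := min_le_right (1 / 2) (ε / (3 * ((r : ℝ) + 1)))
      rw [le_div_iff₀ (by positivity)] at this
      linarith
  have hev := tauberian (fun n => ∑ j ∈ Finset.range (r + 1), pp j n) ((r : ℝ) + 1) (by positivity)
    (fun n => Finset.sum_nonneg fun j _ => pp_nonneg j n) (pp_sum_mono r)
    (by
      intro n
      calc ∑ j ∈ Finset.range (r + 1), pp j n ≤ ∑ j ∈ Finset.range (r + 1), 1 / √((n : ℝ) + 1) :=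
            Finset.sum_le_sum fun i _ => pp_le i n
        _ = _ := by rw [Finset.sum_const, Finset.card_range, nsmul_eq_mul, mul_one_div]; push_cast; rfl)
    (by
      intro ε hε
      have : ∀ᶠ n : ℕ in atTop, ∀ j ∈ Finset.range (r + 1),
          (2 - ε) * √((n : ℝ) + 1) ≤ ∑ i ∈ Finset.range (n + 1), pp j i :=
        (Filter.eventually_all_finset _).2 fun j _ => mean_lower j ε hε
      filter_upwards [this] with n hn
      rw [Finset.sum_comm]
      have := Finset.card_nsmul_le_sum _ _ _ hn
      rw [Finset.card_range, nsmul_eq_mul] at this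
      push_cast at this
      exact this)
    η hη hη1
  filter_upwards [hev] with n hn
  rw [Finset.sum_range_succ, mul_add] at hn
  have hS : 0 < √((n : ℝ) + 1) := Real.sqrt_pos.2 (by positivity)
  have h1 : √((n : ℝ) + 1) * ∑ j ∈ Finset.range r, pp j n ≤ r := by
    calc _ ≤ √((n : ℝ) + 1) * ∑ j ∈ Finset.range r, 1 / √((n : ℝ) + 1) :=
          mul_le_mul_of_nonneg_left (Finset.sum_le_sum fun i _ => pp_le i n) hS.le
      _ = r := by rw [Finset.sum_const, Finset.card_range, nsmul_eq_mul]; field_simp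
  linarith

lemma pp_tendsto (r : ℕ) : Tendsto (fun n : ℕ => √((n : ℝ) + 1) * pp r n) atTop (nhds 1) := by
  apply tendsto_order.2
  constructor
  · intro a ha
    filter_upwards [pp_lower r ((1 - a) / 2) (by linarith)] with n hn
    linarith
  · intro a ha
    refine Eventually.of_forall fun n => ?_
    have hS : 0 < √((n : ℝ) + 1) := Real.sqrt_pos.2 (by positivity)
    have := mul_le_mul_of_nonneg_left (pp_le r n) hS.le
    have e : √((n : ℝ) + 1) * (1 / √((n : ℝ) + 1)) = 1 := by field_simp
    linarith

lemma pp_pos_ev (r : ℕ) : ∀ᶠ n : ℕ in atTop, 0 < pp r n := by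
  filter_upwards [pp_lower r (1 / 2) (by norm_num)] with n hn
  rcases (pp_nonneg r n).eq_or_lt with h | h
  · rw [← h] at hn; norm_num at hn
  · exact h

lemma bound_tendsto (r : ℕ) :
    Tendsto (fun n : ℕ => √(1 / (((n : ℝ) + 1) * pp r n ^ 2) - 1)) atTop (nhds 0) := by
  have h := (((pp_tendsto r).pow 2).inv₀ (by norm_num)).sub_const 1
  have h2 := h.sqrt
  have e : √(((1 : ℝ) ^ 2)⁻¹ - 1) = 0 := by norm_num
  rw [e] at h2
  refine h2.congr fun n => ?_
  rw [mul_pow, Real.sq_sqrt (by positivity), one_div]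

end PlGrowth

namespace PlGrowth

def Ev {Ω : Type*} (lam : ℕ → Ω → YoungDiagram) (m n : ℕ) (path : ℕ → YoungDiagram) : Set Ω :=
  {ω | (lam 0 ω = ⊥ ∧ ∀ i, i < m → lam i ω ≤ lam (i + 1) ω ∧
      (lam (i + 1) ω).card = (lam i ω).card + 1) ∧ ∀ i, m ≤ i → i ≤ n → lam i ω = path i}

lemma countable_yd : Countable YoungDiagram :=
  Function.Injective.countable (f := YoungDiagram.cells) (fun _ _ h => YoungDiagram.ext h)

lemma meas_rel {Ω : Type*} [MeasurableSpace Ω] {lam : ℕ → Ω → YoungDiagram}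
    (hm : ∀ (n : ℕ) (y : YoungDiagram), MeasurableSet {ω | lam n ω = y})
    (i j : ℕ) (R : YoungDiagram → YoungDiagram → Prop) :
    MeasurableSet {ω | R (lam i ω) (lam j ω)} := by
  have := countable_yd
  have : {ω | R (lam i ω) (lam j ω)} =
      ⋃ a, ⋃ b, ⋃ (_ : R a b), ({ω | lam i ω = a} ∩ {ω | lam j ω = b}) := by
    ext ω
    simp only [Set.mem_ofPred_eq, Set.mem_iUnion, Set.mem_inter_iff]
    constructor
    · intro h; exact ⟨_, _, h, rfl, rfl⟩
    · rintro ⟨a, b, h, rfl, rfl⟩; exact h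
  rw [this]
  exact MeasurableSet.iUnion fun a => MeasurableSet.iUnion fun b => MeasurableSet.iUnion fun _ =>
    (hm i a).inter (hm j b)

lemma meas_Ev {Ω : Type*} [MeasurableSpace Ω] {lam : ℕ → Ω → YoungDiagram}
    (hm : ∀ (n : ℕ) (y : YoungDiagram), MeasurableSet {ω | lam n ω = y})
    (m n : ℕ) (path : ℕ → YoungDiagram) : MeasurableSet (Ev lam m n path) := by
  have : Ev lam m n path = ({ω | lam 0 ω = ⊥} ∩ ⋂ i, ⋂ (_ : i < m), {ω | lam i ω ≤ lam (i + 1) ω ∧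
      (lam (i + 1) ω).card = (lam i ω).card + 1}) ∩ ⋂ i, ⋂ (_ : m ≤ i), ⋂ (_ : i ≤ n),
      {ω | lam i ω = path i} := by
    ext ω
    simp [Ev]
  rw [this]
  refine MeasurableSet.inter (MeasurableSet.inter (hm _ _) ?_) ?_
  · exact MeasurableSet.iInter fun i => MeasurableSet.iInter fun _ =>
      meas_rel hm i (i + 1) (fun a b => a ≤ b ∧ b.card = a.card + 1)
  · exact MeasurableSet.iInter fun i => MeasurableSet.iInter fun _ => MeasurableSet.iInter fun _ =>
      hm _ _

lemma prob_Ev {Ω : Type*} [MeasurableSpace Ω] {P : Measure Ω} {lam : ℕ → Ω → YoungDiagram}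
    (hP : IsPlancherelGrowthProcess P lam) (n m : ℕ) : ∀ (path : ℕ → YoungDiagram), m ≤ n →
    (path m).card = m →
    (∀ i, m ≤ i → i < n → path i ≤ path (i + 1) ∧ (path (i + 1)).card = (path i).card + 1) →
    P.real (Ev lam m n path) = dd (path m) * dd (path n) / n.factorial := by
  have := hP.1
  induction m with
  | zero =>
    intro path _ hc hstep
    have h0 : path 0 = ⊥ := by
      have : path 0 ∈ Yn 0 := mem_Yn.2 hc
      rw [Yn_zero] at this
      simpa using this
    have e : Ev lam 0 n path = {ω | ∀ i ≤ n, lam i ω = path i} := by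
      ext ω
      simp only [Ev, Set.mem_ofPred_eq]
      constructor
      · rintro ⟨_, h⟩ i hi; exact h i (Nat.zero_le _) hi
      · intro h
        exact ⟨⟨by rw [h 0 (Nat.zero_le _), h0], fun i hi => absurd hi (Nat.not_lt_zero _)⟩,
          fun i _ hi => h i hi⟩
    rw [e, Measure.real, hP.2.2 n path h0 (fun i hi => hstep i (Nat.zero_le _) hi), h0, dd_bot,
      one_mul, ENNReal.toReal_div]
    simp [dd]
  | succ m ih =>
    intro path hmn hc hstep
    have hU : Ev lam (m + 1) n path =
        ⋃ κ ∈ dn (path (m + 1)), Ev lam m n (Function.update path m κ) := by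
      ext ω
      simp only [Set.mem_iUnion, Ev, Set.mem_ofPred_eq]
      constructor
      · rintro ⟨⟨h0, h1⟩, h2⟩
        refine ⟨lam m ω, ?_, ⟨h0, fun i hi => h1 i (by omega)⟩, ?_⟩
        · rw [mem_dn, ← h2 (m + 1) le_rfl hmn]
          exact h1 m (by omega)
        · intro i hi hin
          rcases hi.eq_or_lt with rfl | hlt
          · simp
          · rw [Function.update_of_ne (by omega)]
            exact h2 i hlt hin
      · rintro ⟨κ, hκ, ⟨h0, h1⟩, h2⟩
        have hmm : lam m ω = κ := by simpa using h2 m le_rfl (by omega)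
        have h2' : ∀ i, m + 1 ≤ i → i ≤ n → lam i ω = path i := by
          intro i hi hin
          have := h2 i (by omega) hin
          rwa [Function.update_of_ne (by omega)] at this
        refine ⟨⟨h0, ?_⟩, h2'⟩
        intro i hi
        rcases (Nat.lt_succ_iff.1 hi).eq_or_lt with rfl | hlt
        · rw [hmm, h2' (i + 1) le_rfl hmn]
          exact mem_dn.1 hκ
        · exact h1 i hlt
    rw [hU, measureReal_biUnion_finset]
    · rw [dd_branch hc, Finset.sum_mul, Finset.sum_div]
      apply Finset.sum_congr rfl
      intro κ hκ
      have hκ' := mem_dn.1 hκ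
      rw [ih (Function.update path m κ) (by omega)]
      · rw [Function.update_self, Function.update_of_ne (by omega)]
      · rw [Function.update_self]; omega
      · intro i hi hin
        rcases hi.eq_or_lt with rfl | hlt
        · rw [Function.update_self, Function.update_of_ne (by omega)]
          exact hκ'
        · rw [Function.update_of_ne (by omega), Function.update_of_ne (by omega)]
          exact hstep i hlt hin
    · intro κ _ κ' _ hne
      apply Set.disjoint_left.2
      intro ω h h'
      apply hne
      have a := h.2 m le_rfl (by omega)
      have b := h'.2 m le_rfl (by omega)
      rw [Function.update_self] at a b
      rw [← a, b]
    · intro κ _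
      exact meas_Ev hP.2.1 _ _ _

lemma prob_lower {Ω : Type*} [MeasurableSpace Ω] {P : Measure Ω} {lam : ℕ → Ω → YoungDiagram}
    (hP : IsPlancherelGrowthProcess P lam) (n : ℕ) (R : YoungDiagram → YoungDiagram → Prop)
    [∀ ν μ, Decidable (R ν μ)] :
    JE n (fun ν μ => if R ν μ then 1 else 0) ≤ P.real {ω | R (lam n ω) (lam (n + 1) ω)} := by
  have := hP.1
  set T : Finset (Σ _ : YoungDiagram, YoungDiagram) :=
    ((Yn n).sigma up).filter (fun p => R p.1 p.2) with hT
  set pth : (Σ _ : YoungDiagram, YoungDiagram) → ℕ → YoungDiagram :=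
    fun p i => if i = n then p.1 else p.2 with hpth
  have hEv : ∀ p ω, ω ∈ Ev lam n (n + 1) (pth p) → lam n ω = p.1 ∧ lam (n + 1) ω = p.2 := by
    intro p ω h
    constructor
    · simpa [hpth] using h.2 n le_rfl (by omega)
    · simpa [hpth] using h.2 (n + 1) (by omega) le_rfl
  have h1 : JE n (fun ν μ => if R ν μ then 1 else 0) = ∑ p ∈ T, P.real (Ev lam n (n + 1) (pth p)) := by
    rw [JE, Finset.sum_sigma', Finset.sum_div, hT, Finset.sum_filter]
    apply Finset.sum_congr rfl
    intro p hp
    rw [Finset.mem_sigma] at hp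
    have h2 := mem_up.1 hp.2
    have h3 := mem_Yn.1 hp.1
    split_ifs
    · rw [prob_Ev hP (n + 1) n (pth p) (by omega)]
      · simp [hpth]
      · simpa [hpth] using h3
      · intro i hi hin
        obtain rfl : i = n := by omega
        simpa [hpth] using h2
    · simp
  rw [h1, ← measureReal_biUnion_finset]
  · refine measureReal_mono ?_ (measure_ne_top _ _)
    intro ω hω
    simp only [Set.mem_iUnion] at hω
    obtain ⟨p, hp, hω⟩ := hω
    obtain ⟨a, b⟩ := hEv p ω hω
    have := (Finset.mem_filter.1 hp).2
    simp only [Set.mem_ofPred_eq]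
    rwa [a, b]
  · intro p _ q _ hne
    apply Set.disjoint_left.2
    intro ω h h'
    apply hne
    obtain ⟨a, b⟩ := hEv p ω h
    obtain ⟨a', b'⟩ := hEv q ω h'
    obtain ⟨p1, p2⟩ := p
    obtain ⟨q1, q2⟩ := q
    simp only at a b a' b'
    rw [← a, ← b, a', b']
  · intro p _
    exact meas_Ev hP.2.1 _ _ _

lemma prob_eq {Ω : Type*} [MeasurableSpace Ω] {P : Measure Ω} {lam : ℕ → Ω → YoungDiagram}
    (hP : IsPlancherelGrowthProcess P lam) (n : ℕ) (R : YoungDiagram → YoungDiagram → Prop)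
    [∀ ν μ, Decidable (R ν μ)] :
    P.real {ω | R (lam n ω) (lam (n + 1) ω)} = JE n (fun ν μ => if R ν μ then 1 else 0) := by
  have := hP.1
  have h1 := prob_lower hP n R
  have h2 := prob_lower hP n (fun a b => ¬ R a b)
  have h3 : JE n (fun ν μ => if R ν μ then 1 else 0) + JE n (fun ν μ => if ¬ R ν μ then 1 else 0) = 1 := by
    rw [← JE_add]
    refine Eq.trans ?_ ((JE_right n (fun _ => 1)).trans (EE_one (n + 1)))
    apply JE_congr
    intro ν μ _ _
    by_cases h : R ν μ <;> simp [h]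
  have h4 := probReal_add_probReal_compl (μ := P) (meas_rel hP.2.1 n (n + 1) R)
  have h5 : {ω | R (lam n ω) (lam (n + 1) ω)}ᶜ = {ω | ¬ R (lam n ω) (lam (n + 1) ω)} := rfl
  rw [h5] at h4
  linarith

lemma box_row_ind {r : ℕ} {ν μ : YoungDiagram} (h : μ ∈ up ν) :
    (if μ.rowLen r = ν.rowLen r + 1 then (1 : ℝ) else 0) = box (rowg r) ν μ := by
  have hc := box_row_cases (r := r) h
  have e : box (rowg r) ν μ = (μ.rowLen r : ℝ) - ν.rowLen r := by
    rw [box, val_rowg, val_rowg]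
  split_ifs with hh
  · rw [e, hh]; push_cast; ring
  · rcases hc with hc | hc
    · exact hc.symm
    · exfalso
      apply hh
      rw [e] at hc
      have : (μ.rowLen r : ℝ) = ν.rowLen r + 1 := by linarith
      exact_mod_cast this

lemma prob_growth {Ω : Type*} [MeasurableSpace Ω] {P : Measure Ω} {lam : ℕ → Ω → YoungDiagram}
    (hP : IsPlancherelGrowthProcess P lam) (n r : ℕ) :
    (P (growthEvent lam n r)).toReal = pp r n := by
  have h := prob_eq hP n (fun ν μ => μ.rowLen r = ν.rowLen r + 1)
  rw [pp]
  refine h.trans ?_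
  apply JE_congr
  intro ν μ _ hμ
  rw [← box_row_ind hμ]

lemma prob_joint {Ω : Type*} [MeasurableSpace Ω] {P : Measure Ω} {lam : ℕ → Ω → YoungDiagram}
    (hP : IsPlancherelGrowthProcess P lam) (n r : ℕ) (μ₀ : YoungDiagram) :
    (P ({ω | lam (n + 1) ω = μ₀} ∩ growthEvent lam n r)).toReal =
      if μ₀.card = n + 1 then dd μ₀ * SR r μ₀ / (n + 1).factorial else 0 := by
  classical
  have h := prob_eq hP n (fun ν μ => μ = μ₀ ∧ μ.rowLen r = ν.rowLen r + 1)
  refine h.trans ?_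
  rw [JE, sum_up_dn n (fun ν μ => dd ν * dd μ * if μ = μ₀ ∧ μ.rowLen r = ν.rowLen r + 1 then (1 : ℝ) else 0)]
  have e : ∀ μ ∈ Yn (n + 1), (∑ ν ∈ dn μ, dd ν * dd μ *
      if μ = μ₀ ∧ μ.rowLen r = ν.rowLen r + 1 then (1 : ℝ) else 0) =
      if μ = μ₀ then dd μ₀ * SR r μ₀ else 0 := by
    intro μ _
    by_cases hμ : μ = μ₀
    · subst hμ
      simp only [true_and, if_true]
      rw [SR, Finset.mul_sum]
      apply Finset.sum_congr rfl
      intro ν hν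
      have hb := box_row_ind (r := r) (mem_up.2 (mem_dn.1 hν))
      rw [← hb]
      ring
    · simp [hμ]
  rw [Finset.sum_congr rfl e, Finset.sum_ite_eq']
  simp only [mem_Yn]
  split_ifs <;> simp

end PlGrowth

/-- Fix a row index `r`.  The total variation distance between the Plancherel measure `Pl_n`
(the distribution of `λ⁽ⁿ⁾`) and the conditional distribution of `λ⁽ⁿ⁾` given the event
`E_r⁽ⁿ⁾` that the box added at step `n` lies in row `r` converges to `0` as `n → ∞`.
(With our indexing, step `n+1`: the event is `growthEvent lam n r` and the diagram is
`lam (n+1)`; the conditional probability of `μ` is `ℙ({lam (n+1) = μ} ∩ E) / ℙ(E)`.) -/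
theorem tv_conditional_given_row_growth_tendsto_zero {Ω : Type*} [MeasurableSpace Ω]
    (P : Measure Ω) (lam : ℕ → Ω → YoungDiagram)
    (hPGP : IsPlancherelGrowthProcess P lam) (r : ℕ) :
    Filter.Tendsto
      (fun n : ℕ => (1 / 2) * ∑' μ : YoungDiagram,
        |plancherelProb (n + 1) μ -
          (P ({ω | lam (n + 1) ω = μ} ∩ growthEvent lam n r)).toReal /
            (P (growthEvent lam n r)).toReal|)
      Filter.atTop (nhds 0) := by
  have hlim : Tendsto (fun n : ℕ => (1 / 2) * √(1 / (((n : ℝ) + 1) * PlGrowth.pp r n ^ 2) - 1))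
      atTop (nhds 0) := by
    simpa using (PlGrowth.bound_tendsto r).const_mul (1 / 2 : ℝ)
  refine squeeze_zero' (Eventually.of_forall fun n => ?_) ?_ hlim
  · exact mul_nonneg (by norm_num) (tsum_nonneg fun _ => abs_nonneg _)
  · filter_upwards [PlGrowth.pp_pos_ev r] with n hn
    apply mul_le_mul_of_nonneg_left _ (by norm_num)
    rw [tsum_eq_sum (s := PlGrowth.Yn (n + 1))]
    · refine le_trans (le_of_eq ?_) (PlGrowth.tv_bound r n hn)
      apply Finset.sum_congr rfl
      intro μ hμ
      have hc := PlGrowth.mem_Yn.1 hμ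
      rw [PlGrowth.prob_joint hPGP, PlGrowth.prob_growth hPGP, plancherelProb, if_pos hc, if_pos hc]
      rfl
    · intro μ hμ
      have hc : ¬ μ.card = n + 1 := fun h => hμ (PlGrowth.mem_Yn.2 h)
      rw [PlGrowth.prob_joint hPGP, plancherelProb, if_neg hc, if_neg hc]
      simp
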